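/- arXiv:1508.00098 — 3 statements merged into one kernel-verified Lean document; each statement's English description precedes it below -/
import Mathlib

section
/- For every v ∈ {115, 133} there exists a super-simple 2-(v,4,2) directed design whose every defining set contains at least half of the total number of blocks. -/
/-- A `t-(v,k,λ)` directed design on the point type `X`: a collection of
blocks, each an ordered `k`-tuple (a duplicate-free list of length `k`) of
points, such that every ordered `t`-tuple of distinct points occurs, in the
given order (i.e. as a sublist), in exactly `lam` blocks. -/
structure DirectedDesign (X : Type*) [DecidableEq X] (t k lam : ℕ) where
  blocks : Multiset (List X)
  len : ∀ b ∈ blocks, b.length = k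
  nodup : ∀ b ∈ blocks, b.Nodup
  covers : ∀ s : List X, s.length = t → s.Nodup →
    blocks.countP (fun b => s.Sublist b) = lam

/-- A directed design is super-simple if it has no repeated blocks and any two
distinct blocks have at most 2 points in common. -/
def DirectedDesign.SuperSimple {X : Type*} [DecidableEq X] {t k lam : ℕ}
    (D : DirectedDesign X t k lam) : Prop :=
  D.blocks.Nodup ∧
    ∀ b₁ ∈ D.blocks, ∀ b₂ ∈ D.blocks, b₁ ≠ b₂ →
      (b₁.toFinset ∩ b₂.toFinset).card ≤ 2

/-- `S` is a defining set of the directed design `D` if `S` is a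
subcollection of the blocks of `D` and `D.blocks` is the unique block
collection of a `t-(v,k,λ)` directed design on the same point set
containing `S`. -/
def DirectedDesign.IsDefiningSet {X : Type*} [DecidableEq X] {t k lam : ℕ}
    (D : DirectedDesign X t k lam) (S : Multiset (List X)) : Prop :=
  S ≤ D.blocks ∧
    ∀ D' : DirectedDesign X t k lam, S ≤ D'.blocks → D'.blocks = D.blocks

/-- Every defining set of `D` contains at least half of the blocks
(the paper's condition `d ≥ 1/2`). -/
def DirectedDesign.DefiningHalf {X : Type*} [DecidableEq X] {t k lam : ℕ}
    (D : DirectedDesign X t k lam) : Prop :=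
  ∀ S : Multiset (List X), D.IsDefiningSet S →
    Multiset.card D.blocks ≤ 2 * Multiset.card S

/-- A `(v,k,t)` directed trade `T = T₁ - T₂`: two disjoint nonempty
collections of blocks of the same volume such that every ordered `t`-tuple
of distinct points is covered by equally many blocks of `T₁` as of `T₂`. -/
structure DirectedTrade (X : Type*) [DecidableEq X] (k t : ℕ) where
  pos : Multiset (List X)
  neg : Multiset (List X)
  pos_len : ∀ b ∈ pos, b.length = k
  pos_nodup : ∀ b ∈ pos, b.Nodup
  neg_len : ∀ b ∈ neg, b.length = k
  neg_nodup : ∀ b ∈ neg, b.Nodup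
  disjoint : Disjoint pos neg
  pos_ne : pos ≠ 0
  card_eq : Multiset.card pos = Multiset.card neg
  balanced : ∀ s : List X, s.length = t → s.Nodup →
    pos.countP (fun b => s.Sublist b) = neg.countP (fun b => s.Sublist b)

/-- A `(k,λ)` directed group divisible design (DGDD) with the given group set
`groups`: blocks are ordered `k`-tuples of distinct points meeting each group
in at most one point, and every ordered pair of distinct points from
different groups occurs, in order, in exactly `lam` blocks. -/
structure DGDD (X : Type*) [DecidableEq X] (groups : Finset (Finset X))
    (k lam : ℕ) where
  blocks : Multiset (List X)
  len : ∀ b ∈ blocks, b.length = k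
  nodup : ∀ b ∈ blocks, b.Nodup
  transverse : ∀ b ∈ blocks, ∀ G ∈ groups, (b.toFinset ∩ G).card ≤ 1
  covers : ∀ x y : X, x ≠ y → (∀ G ∈ groups, ¬(x ∈ G ∧ y ∈ G)) →
    blocks.countP (fun b => [x, y].Sublist b) = lam

/-- A DGDD is super-simple if it has no repeated blocks and any two distinct
blocks have at most 2 points in common. -/
def DGDD.SuperSimple {X : Type*} [DecidableEq X] {groups : Finset (Finset X)}
    {k lam : ℕ} (D : DGDD X groups k lam) : Prop :=
  D.blocks.Nodup ∧
    ∀ b₁ ∈ D.blocks, ∀ b₂ ∈ D.blocks, b₁ ≠ b₂ →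
      (b₁.toFinset ∩ b₂.toFinset).card ≤ 2

/-- `S` is a defining set of the DGDD `D` if `S` is a subcollection of the
blocks of `D` and `D.blocks` is the unique block collection of a
`(k,λ)`-DGDD with the same groups containing `S`. -/
def DGDD.IsDefiningSet {X : Type*} [DecidableEq X] {groups : Finset (Finset X)}
    {k lam : ℕ} (D : DGDD X groups k lam) (S : Multiset (List X)) : Prop :=
  S ≤ D.blocks ∧
    ∀ D' : DGDD X groups k lam, S ≤ D'.blocks → D'.blocks = D.blocks

/-- Every defining set of the DGDD `D` contains at least half of the blocks. -/
def DGDD.DefiningHalf {X : Type*} [DecidableEq X] {groups : Finset (Finset X)}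
    {k lam : ℕ} (D : DGDD X groups k lam) : Prop :=
  ∀ S : Multiset (List X), D.IsDefiningSet S →
    Multiset.card D.blocks ≤ 2 * Multiset.card S

/-- A (undirected) `(K,λ)` group divisible design with the given group set
`groups`: blocks are subsets of the point set with sizes in `K` meeting each
group in at most one point, and every pair of distinct points from different
groups lies in exactly `lam` blocks. -/
structure GDD (X : Type*) [DecidableEq X] (groups : Finset (Finset X))
    (K : Finset ℕ) (lam : ℕ) where
  blocks : Multiset (Finset X)
  size_mem : ∀ b ∈ blocks, b.card ∈ K
  transverse : ∀ b ∈ blocks, ∀ G ∈ groups, (b ∩ G).card ≤ 1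
  covers : ∀ x y : X, x ≠ y → (∀ G ∈ groups, ¬(x ∈ G ∧ y ∈ G)) →
    blocks.countP (fun b => x ∈ b ∧ y ∈ b) = lam

/-- `groups` is a partition of the point type `X`: every point lies in
exactly one group. -/
def IsGroupPartition {X : Type*} (groups : Finset (Finset X)) : Prop :=
  ∀ x : X, ∃! G, G ∈ groups ∧ x ∈ G


section Construction

variable {G : Type} [AddCommGroup G] [Fintype G] [DecidableEq G]

/-- The two base blocks attached to a triple `(b,c,d)`: the block `(0,b,c,d)` and its image
under `x ↦ b - x`. -/
def baseBlk (t : G × G × G) (s : Bool) : List G :=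
  match s with
  | true => [0, t.1, t.2.1, t.2.2]
  | false => [t.1, 0, t.1 - t.2.1, t.1 - t.2.2]

/-- Translates of the base blocks. -/
def blk (p : (G × G × G) × Bool × G) : List G :=
  (baseBlk p.1 p.2.1).map (fun z => z + p.2.2)

/-- The partner of a block in the volume two trade. -/
def blkTwist (p : (G × G × G) × Bool × G) : List G :=
  match p.2.1 with
  | true => [p.1.1 + p.2.2, 0 + p.2.2, p.1.2.1 + p.2.2, p.1.2.2 + p.2.2]
  | false => [0 + p.2.2, p.1.1 + p.2.2, p.1.1 - p.1.2.1 + p.2.2, p.1.1 - p.1.2.2 + p.2.2]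

/-- number of forward differences of a base block equal to `d` -/
def qdiff (d : G) : List G → ℕ
  | [] => 0
  | a :: l => l.countP (fun z => z - a = d) + qdiff d l

def flipIdx (p : (G × G × G) × Bool × G) : (G × G × G) × Bool × G := (p.1, !p.2.1, p.2.2)

/-- All blocks. -/
def allBlocks (L : List (G × G × G)) : Multiset (List G) :=
  (L.toFinset ×ˢ (Finset.univ : Finset (Bool × G))).val.map blk

theorem sub4 {a b c d x y : G} (h : [a, b, c, d].Nodup) :
    (if [x, y].Sublist [a, b, c, d] then 1 else 0 : ℕ) =
      (if x = a ∧ y = b then 1 else 0) + (if x = a ∧ y = c then 1 else 0) +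
      (if x = a ∧ y = d then 1 else 0) + (if x = b ∧ y = c then 1 else 0) +
      (if x = b ∧ y = d then 1 else 0) + (if x = c ∧ y = d then 1 else 0) := by
  have key : [x, y].Sublist [a, b, c, d] ↔ (x = a ∧ y = b) ∨ (x = a ∧ y = c) ∨ (x = a ∧ y = d) ∨
      (x = b ∧ y = c) ∨ (x = b ∧ y = d) ∨ (x = c ∧ y = d) := by
    constructor
    · intro h
      simp only [List.sublist_cons_iff, List.cons.injEq] at h
      simp at h
      grind
    · rintro (⟨rfl, rfl⟩ | ⟨rfl, rfl⟩ | ⟨rfl, rfl⟩ | ⟨rfl, rfl⟩ | ⟨rfl, rfl⟩ | ⟨rfl, rfl⟩) <;>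
        simp [List.sublist_cons_iff]
  simp only [List.nodup_cons, List.mem_cons, List.not_mem_nil, or_false, not_or] at h
  obtain ⟨⟨h1, h2, h3⟩, ⟨h4, h5⟩, h6, -⟩ := h
  rw [if_congr key rfl rfl]
  by_cases ha : x = a
  · subst ha; grind
  by_cases hb : x = b
  · subst hb; grind
  by_cases hc : x = c
  · subst hc; grind
  simp [ha, hb, hc]

theorem sum_ind (x y a b : G) :
    (∑ g : G, if x = a + g ∧ y = b + g then 1 else 0 : ℕ) = if b - a = y - x then 1 else 0 := by
  rw [Finset.sum_eq_single (x - a)]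
  · refine if_congr ⟨fun h => ?_, fun h => ?_⟩ rfl rfl
    · rw [h.2]; abel
    · refine ⟨by abel, ?_⟩
      have : y = b - a + x := by rw [h]; abel
      rw [this]; abel
  · intro g _ hg
    rw [if_neg]
    rintro ⟨h, -⟩
    exact hg (by rw [h]; abel)
  · simp

theorem sum_translates (l : List G) (hl : l.length = 4) (hn : l.Nodup) (x y : G) :
    (∑ g : G, if [x, y].Sublist (l.map (fun z => z + g)) then 1 else 0 : ℕ) = qdiff (y - x) l := by
  match l, hl with
  | [a, b, c, d], _ =>
    have : ∀ g : G, [a + g, b + g, c + g, d + g].Nodup := by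
      intro g
      have := hn.map (f := fun z => z + g) (add_left_injective g)
      simpa using this
    simp only [List.map_cons, List.map_nil]
    simp only [fun g => sub4 (x := x) (y := y) (this g), Finset.sum_add_distrib, sum_ind]
    simp only [qdiff, List.countP_cons, List.countP_nil, decide_eq_true_eq]
    ring

/-- The finite conditions to be checked. -/
structure Good (L : List (G × G × G)) : Prop where
  nodup : L.Nodup
  base_nodup : ∀ t ∈ L, ∀ s, (baseBlk t s).Nodup
  diff : ∀ d : G, d ≠ 0 →
    (L.map (fun t => qdiff d (baseBlk t true) + qdiff d (baseBlk t false))).sum = 2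
  inter : ∀ t ∈ L, ∀ t' ∈ L, ∀ s s' : Bool, ∀ x ∈ baseBlk t s, ∀ y ∈ baseBlk t' s',
    (t = t' ∧ s = s' ∧ x = y) ∨ (baseBlk t s).countP (fun z => z - x + y ∈ baseBlk t' s') ≤ 2

variable {L : List (G × G × G)}

theorem baseBlk_length (t : G × G × G) (s : Bool) : (baseBlk t s).length = 4 := by
  cases s <;> rfl

theorem blk_nodup (hL : Good L) {p : (G × G × G) × Bool × G} (hp : p.1 ∈ L) : (blk p).Nodup :=
  (hL.base_nodup _ hp _).map (add_left_injective _)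

theorem Good.blk_inter (hL : Good L) {p q : (G × G × G) × Bool × G} (hp : p.1 ∈ L) (hq : q.1 ∈ L)
    (hpq : p ≠ q) : ((blk p).toFinset ∩ (blk q).toFinset).card ≤ 2 := by
  by_contra hcon
  push Not at hcon
  obtain ⟨w, hw⟩ : ((blk p).toFinset ∩ (blk q).toFinset).Nonempty := by
    rw [← Finset.card_pos]; omega
  obtain ⟨t, s, g⟩ := p
  obtain ⟨t', s', h⟩ := q
  simp only [blk, Finset.mem_inter, List.mem_toFinset, List.mem_map] at hw hp hq
  obtain ⟨⟨x, hx, hxw⟩, ⟨y, hy, hyw⟩⟩ := hw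
  rcases hL.inter t hp t' hq s s' x hx y hy with ⟨h1, h2, h3⟩ | h1
  · subst h1 h2 h3
    apply hpq
    have : g = h := by
      rw [← hyw] at hxw
      exact add_left_cancel hxw
    rw [this]
  · have hle : ((blk (t, s, g)).toFinset ∩ (blk (t', s', h)).toFinset).card ≤
        (baseBlk t s).countP (fun z => z - x + y ∈ baseBlk t' s') := by
      rw [List.countP_eq_length_filter]
      refine le_trans (Finset.card_le_card (t := (((baseBlk t s).filter
        (fun z => z - x + y ∈ baseBlk t' s')).map (fun z => z + g)).toFinset) ?_) ?_
      · intro u hu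
        simp only [blk, Finset.mem_inter, List.mem_toFinset, List.mem_map] at hu
        obtain ⟨⟨a, ha, hau⟩, ⟨b, hb, hbu⟩⟩ := hu
        simp only [List.mem_toFinset, List.mem_map, List.mem_filter, decide_eq_true_eq]
        refine ⟨a, ⟨ha, ?_⟩, hau⟩
        have : a - x + y = b := by
          have e1 : a = u - g := by rw [← hau]; abel
          have e2 : b = u - h := by rw [← hbu]; abel
          have e3 : x = w - g := by rw [← hxw]; abel
          have e4 : y = w - h := by rw [← hyw]; abel
          rw [e1, e2, e3, e4]; abel
        rw [this]; exact hb
      · exact (List.toFinset_card_le _).trans (by simp)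
    omega

theorem Good.blk_card (hL : Good L) {p : (G × G × G) × Bool × G} (hp : p.1 ∈ L) :
    (blk p).toFinset.card = 4 := by
  rw [List.toFinset_card_of_nodup (blk_nodup hL hp)]
  simp [blk, baseBlk_length]

theorem Good.blk_inj (hL : Good L) {p q : (G × G × G) × Bool × G} (hp : p.1 ∈ L) (hq : q.1 ∈ L)
    (h : blk p = blk q) : p = q := by
  by_contra hpq
  have := hL.blk_inter hp hq hpq
  rw [← h, Finset.inter_self, hL.blk_card hp] at this
  omega

theorem mem_allBlocks {b : List G} : b ∈ allBlocks L ↔ ∃ p, p.1 ∈ L ∧ blk p = b := by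
  simp only [allBlocks, Multiset.mem_map, Finset.mem_val, Finset.mem_product, List.mem_toFinset,
    Finset.mem_univ, and_true]

theorem Good.allBlocks_nodup (hL : Good L) : (allBlocks L).Nodup := by
  refine Multiset.Nodup.map_on ?_ (Finset.nodup _)
  intro p hp q hq h
  simp only [Finset.mem_val, Finset.mem_product, List.mem_toFinset] at hp hq
  exact hL.blk_inj hp.1 hq.1 h

/-- The design. -/
def Good.design (hL : Good L) : DirectedDesign G 2 4 2 where
  blocks := allBlocks L
  len := by
    intro b hb
    obtain ⟨p, -, rfl⟩ := mem_allBlocks.1 hb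
    simp [blk, baseBlk_length]
  nodup := by
    intro b hb
    obtain ⟨p, hp, rfl⟩ := mem_allBlocks.1 hb
    exact blk_nodup hL hp
  covers := by
    intro s hs hn
    match s, hs with
    | [x, y], _ =>
      have hxy : y - x ≠ 0 := by
        intro h
        simp [sub_eq_zero.1 h] at hn
      rw [← hL.diff _ hxy, ← List.sum_toFinset _ hL.nodup, allBlocks, Multiset.countP_map,
        ← Finset.filter_val, Finset.card_val, Finset.card_filter, Finset.sum_product]
      refine Finset.sum_congr rfl fun t ht => ?_
      rw [List.mem_toFinset] at ht
      rw [Fintype.sum_prod_type, Fintype.sum_bool]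
      exact congrArg₂ (· + ·) (sum_translates _ (baseBlk_length _ _) (hL.base_nodup t ht true) x y)
        (sum_translates _ (baseBlk_length _ _) (hL.base_nodup t ht false) x y)

theorem Good.superSimple (hL : Good L) : hL.design.SuperSimple := by
  refine ⟨hL.allBlocks_nodup, ?_⟩
  intro b₁ h₁ b₂ h₂ hne
  obtain ⟨p, hp, rfl⟩ := mem_allBlocks.1 h₁
  obtain ⟨q, hq, rfl⟩ := mem_allBlocks.1 h₂
  exact hL.blk_inter hp hq (fun h => hne (by rw [h]))

theorem twist_perm (p : (G × G × G) × Bool × G) : (blkTwist p).Perm (blk p) := by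
  obtain ⟨t, s, g⟩ := p
  cases s
  · exact List.Perm.swap _ _ _
  · exact List.Perm.swap _ _ _

theorem Good.twist_not_mem (hL : Good L) {p : (G × G × G) × Bool × G} (hp : p.1 ∈ L) :
    blkTwist p ∉ allBlocks L := by
  intro h
  obtain ⟨q, hq, hqp⟩ := mem_allBlocks.1 h
  have hpq : p ≠ q := by
    rintro rfl
    have hn := blk_nodup hL hp
    obtain ⟨t, s, g⟩ := p
    cases s <;> simp [blk, blkTwist, baseBlk] at hqp hn <;> simp_all
  have := hL.blk_inter hp hq hpq
  rw [hqp, List.toFinset_eq_of_perm _ _ (twist_perm p), Finset.inter_self, hL.blk_card hp] at this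
  omega

theorem trade_count (hL : Good L) {t : G × G × G} (ht : t ∈ L) (g x y : G) :
    (if [x, y].Sublist (blk (t, true, g)) then 1 else 0 : ℕ) +
      (if [x, y].Sublist (blk (t, false, g)) then 1 else 0) =
    (if [x, y].Sublist (blkTwist (t, true, g)) then 1 else 0) +
      (if [x, y].Sublist (blkTwist (t, false, g)) then 1 else 0) := by
  have h1 := blk_nodup hL (p := (t, true, g)) ht
  have h2 := blk_nodup hL (p := (t, false, g)) ht
  have h3 := (twist_perm (t, true, g)).nodup_iff.2 h1
  have h4 := (twist_perm (t, false, g)).nodup_iff.2 h2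
  refine (congrArg₂ (· + ·) (sub4 h1) (sub4 h2)).trans
    (Eq.trans ?_ (congrArg₂ (· + ·) (sub4 h3) (sub4 h4)).symm)
  ring

theorem Good.exists_trade (hL : Good L) {t : G × G × G} (ht : t ∈ L) (g : G)
    (S : Multiset (List G)) (hS : S ≤ allBlocks L) (h1 : blk (t, true, g) ∉ S)
    (h2 : blk (t, false, g) ∉ S) :
    ∃ D' : DirectedDesign G 2 4 2, S ≤ D'.blocks ∧ D'.blocks ≠ allBlocks L := by
  have m1 : blk (t, true, g) ∈ allBlocks L := mem_allBlocks.2 ⟨_, ht, rfl⟩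
  have m2 : blk (t, false, g) ∈ allBlocks L := mem_allBlocks.2 ⟨_, ht, rfl⟩
  have hne : blk (t, false, g) ≠ blk (t, true, g) := by
    intro h
    have := hL.blk_inj (p := (t, false, g)) (q := (t, true, g)) ht ht h
    simp at this
  obtain ⟨R, hR⟩ := Multiset.exists_cons_of_mem m1
  have m3 : blk (t, false, g) ∈ R := by
    rw [hR, Multiset.mem_cons] at m2
    exact m2.resolve_left hne
  obtain ⟨Q, hQ⟩ := Multiset.exists_cons_of_mem m3
  subst hQ
  have hSQ : S ≤ Q := by
    rw [hR] at hS
    exact (Multiset.le_cons_of_notMem h2).1 ((Multiset.le_cons_of_notMem h1).1 hS)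
  have hperm : ∀ b ∈ blkTwist (t, true, g) ::ₘ blkTwist (t, false, g) ::ₘ Q,
      b.length = 4 ∧ b.Nodup := by
    intro b hb
    simp only [Multiset.mem_cons] at hb
    rcases hb with rfl | rfl | hb
    · exact ⟨by rfl, (twist_perm _).nodup_iff.2 (blk_nodup hL ht)⟩
    · exact ⟨by rfl, (twist_perm _).nodup_iff.2 (blk_nodup hL ht)⟩
    · have : b ∈ allBlocks L := by rw [hR]; simp [hb]
      exact ⟨hL.design.len b this, hL.design.nodup b this⟩
  refine ⟨⟨blkTwist (t, true, g) ::ₘ blkTwist (t, false, g) ::ₘ Q, fun b hb => (hperm b hb).1,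
    fun b hb => (hperm b hb).2, ?_⟩, ?_, ?_⟩
  · intro s hs hn
    have hc := hL.design.covers s hs hn
    change (allBlocks L).countP _ = 2 at hc
    rw [hR] at hc
    match s, hs with
    | [x, y], _ =>
      have := trade_count hL ht g x y
      simp only [Multiset.countP_cons] at hc ⊢
      omega
  · exact hSQ.trans ((Multiset.le_cons_self _ _).trans (Multiset.le_cons_self _ _))
  · intro h
    apply hL.twist_not_mem (p := (t, true, g)) ht
    rw [← h]
    simp

theorem Good.definingHalf (hL : Good L) : hL.design.DefiningHalf := by
  intro S hS
  obtain ⟨hle, huniq⟩ := hS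
  change S ≤ allBlocks L at hle
  change Multiset.card (allBlocks L) ≤ _
  set I := L.toFinset ×ˢ (Finset.univ : Finset (Bool × G)) with hI
  have hmem : ∀ p ∈ I, blk p ∈ S ∨ blk (flipIdx p) ∈ S := by
    intro p hp
    by_contra hcon
    push Not at hcon
    rw [hI, Finset.mem_product, List.mem_toFinset] at hp
    obtain ⟨t, s, g⟩ := p
    have : blk (t, true, g) ∉ S ∧ blk (t, false, g) ∉ S := by
      cases s
      · exact ⟨hcon.2, hcon.1⟩
      · exact hcon
    obtain ⟨D', h1, h2⟩ := hL.exists_trade hp.1 g S hle this.1 this.2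
    exact h2 (huniq D' h1)
  have hA : (I.filter (fun p => blk p ∈ S)).card ≤ Multiset.card S := by
    refine le_trans (Finset.card_le_card_of_injOn (t := S.toFinset) blk ?_ ?_)
      (Multiset.toFinset_card_le S)
    · intro p hp
      simp at hp ⊢
      exact hp.2
    · intro p hp q hq h
      simp [hI] at hp hq
      exact hL.blk_inj hp.1 hq.1 h
  have hB : (I.filter (fun p => blk (flipIdx p) ∈ S)).card ≤
      (I.filter (fun p => blk p ∈ S)).card := by
    refine Finset.card_le_card_of_injOn flipIdx ?_ ?_
    · intro p hp
      simp [hI, flipIdx] at hp ⊢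
      exact hp
    · intro p _ q _ h
      simp [flipIdx] at h
      ext1
      · exact h.1
      · ext1
        · exact h.2.1
        · exact h.2.2
  have hC : I.card ≤ (I.filter (fun p => blk p ∈ S)).card +
      (I.filter (fun p => blk (flipIdx p) ∈ S)).card := by
    refine le_trans (Finset.card_le_card ?_) (Finset.card_union_le _ _)
    intro p hp
    rw [Finset.mem_union, Finset.mem_filter, Finset.mem_filter]
    exact (hmem p hp).imp (fun h => ⟨hp, h⟩) (fun h => ⟨hp, h⟩)
  have hD : Multiset.card (allBlocks L) = I.card := by
    simp only [allBlocks, Multiset.card_map, Finset.card_val, hI]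
  omega

end Construction


/-! Evaluation of the finite conditions on natural number representatives. -/

def natDiff (n d : ℕ) : List ℕ → ℕ
  | [] => 0
  | a :: l => l.countP (fun z => Nat.beq ((n - a + z) % n) d) + natDiff n d l

def natDiffSum (n d : ℕ) : List (List ℕ) → ℕ
  | [] => 0
  | b :: K => natDiff n d b + natDiffSum n d K

def diffCheck (n : ℕ) (K : List (List ℕ)) : Bool :=
  (List.range n).all fun d => Nat.beq d 0 || Nat.beq (natDiffSum n d K) 2

/-- A bitmask test that a list of natural numbers has no repetitions. -/
def nodupMask (m : ℕ) : List ℕ → Bool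
  | [] => true
  | a :: l => !Nat.testBit m a && nodupMask (m ||| 2 ^ a) l

/-- All configurations: a block with three of its points in some order. -/
def configs (K : List (List ℕ)) : List (List ℕ × ℕ × ℕ × ℕ) :=
  K.flatMap fun b => b.flatMap fun x => (b.filter fun z => !Nat.beq x z).flatMap fun z =>
    (b.filter fun w => !Nat.beq x w && !Nat.beq z w).map fun w => (b, x, z, w)

def code (n : ℕ) (c : List ℕ × ℕ × ℕ × ℕ) : ℕ :=
  (n - c.2.1 + c.2.2.1) % n * n + (n - c.2.1 + c.2.2.2) % n

def interCheck (n : ℕ) (K : List (List ℕ)) : Bool :=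
  nodupMask 0 ((configs K).map (code n))

/-- The two base blocks on natural number representatives. -/
def natBase (n : ℕ) (t : ℕ × ℕ × ℕ) : List (List ℕ) :=
  [[0, t.1 % n, t.2.1 % n, t.2.2 % n],
   [t.1 % n, 0, (n - t.2.1 % n + t.1 % n) % n, (n - t.2.2 % n + t.1 % n) % n]]

theorem nodupMask_spec (l : List ℕ) (m : ℕ) (h : nodupMask m l = true) :
    l.Nodup ∧ ∀ a ∈ l, Nat.testBit m a = false := by
  induction l generalizing m with
  | nil => simp
  | cons a l ih =>
    rw [nodupMask, Bool.and_eq_true, Bool.not_eq_true'] at h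
    obtain ⟨h1, h2⟩ := ih _ h.2
    refine ⟨List.nodup_cons.2 ⟨fun ha => ?_, h1⟩, ?_⟩
    · have := h2 a ha
      simp [Nat.testBit_or, Nat.testBit_two_pow_self] at this
    · intro c hc
      rcases List.mem_cons.1 hc with rfl | hc
      · exact h.1
      · have := h2 c hc
        rw [Nat.testBit_or, Bool.or_eq_false_iff] at this
        exact this.1

theorem mem_configs {K : List (List ℕ)} {b : List ℕ} {x z w : ℕ} (hb : b ∈ K) (hx : x ∈ b)
    (hz : z ∈ b) (hw : w ∈ b) (h1 : x ≠ z) (h2 : x ≠ w) (h3 : z ≠ w) :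
    (b, x, z, w) ∈ configs K := by
  simp only [configs, List.mem_flatMap, List.mem_map, List.mem_filter, Bool.and_eq_true,
    Bool.not_eq_true', Bool.eq_false_iff, ne_eq, Nat.beq_eq]
  exact ⟨b, hb, x, hx, z, ⟨hz, h1⟩, w, ⟨hw, h2, h3⟩, rfl⟩


section Bridge

variable {n : ℕ} [NeZero n]

/-- The base blocks as lists of natural numbers. -/
def natBlocks (L : List (Fin n × Fin n × Fin n)) : List (List ℕ) :=
  L.flatMap fun t => [(baseBlk t true).map Fin.val, (baseBlk t false).map Fin.val]

theorem mem_natBlocks {L : List (Fin n × Fin n × Fin n)} {t : Fin n × Fin n × Fin n}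
    (ht : t ∈ L) (s : Bool) : (baseBlk t s).map Fin.val ∈ natBlocks L := by
  rw [natBlocks, List.mem_flatMap]
  refine ⟨t, ht, ?_⟩
  cases s <;> simp

theorem qdiff_eq (d : Fin n) (l : List (Fin n)) :
    qdiff d l = natDiff n d.val (l.map Fin.val) := by
  induction l with
  | nil => rfl
  | cons a l ih =>
    rw [List.map_cons, qdiff, natDiff, ih, List.countP_map]
    congr 1
    apply List.countP_congr
    intro z _
    simp [Fin.ext_iff, Fin.sub_def]

theorem sum_qdiff_eq (d : Fin n) (L : List (Fin n × Fin n × Fin n)) :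
    (L.map (fun t => qdiff d (baseBlk t true) + qdiff d (baseBlk t false))).sum =
      natDiffSum n d.val (natBlocks L) := by
  induction L with
  | nil => rfl
  | cons t L ih =>
    rw [List.map_cons, List.sum_cons, ih, qdiff_eq, qdiff_eq]
    change _ = natDiff n d.val _ + (natDiff n d.val _ + natDiffSum n d.val (natBlocks L))
    rw [add_assoc]

theorem baseBlk_inj {t t' : Fin n × Fin n × Fin n} {s s' : Bool} (h1 : (baseBlk t s).Nodup)
    (h : baseBlk t s = baseBlk t' s') : t = t' ∧ s = s' := by
  obtain ⟨b, c, d⟩ := t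
  obtain ⟨b', c', d'⟩ := t'
  cases s <;> cases s' <;> simp [baseBlk] at h h1 ⊢ <;> grind

theorem val_diff (z x : Fin n) : (z - x).val = (n - x.val + z.val) % n := by
  rw [Fin.sub_def]

/-- Triples of residues from triples of natural numbers. -/
def toTriples (n : ℕ) [NeZero n] (N : List (ℕ × ℕ × ℕ)) : List (Fin n × Fin n × Fin n) :=
  N.map fun t => (Fin.ofNat n t.1, Fin.ofNat n t.2.1, Fin.ofNat n t.2.2)

theorem natBlocks_toTriples (N : List (ℕ × ℕ × ℕ)) :
    natBlocks (toTriples n N) = N.flatMap (natBase n) := by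
  rw [natBlocks, toTriples, List.flatMap_map]
  congr 1

theorem good_of_check {N : List (ℕ × ℕ × ℕ)} {K : List (List ℕ)}
    (hK : N.flatMap (natBase n) = K)
    (hN : (N.map fun t => t.1 % n * n + t.2.1 % n).Nodup) (hb : ∀ b ∈ K, b.Nodup)
    (hd : diffCheck n K = true) (hi : interCheck n K = true) : Good (toTriples n N) := by
  rw [← natBlocks_toTriples] at hK
  have hL : (toTriples n N).Nodup := by
    have : ((toTriples n N).map fun t => t.1.val * n + t.2.1.val).Nodup := by
      rw [toTriples, List.map_map]
      exact hN
    exact this.of_map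
  have hbase : ∀ t ∈ toTriples n N, ∀ s, (baseBlk t s).Nodup := by
    intro t ht s
    exact (hb _ (hK ▸ mem_natBlocks ht s)).of_map
  refine ⟨hL, hbase, ?_, ?_⟩
  · intro d hd0
    rw [sum_qdiff_eq, hK]
    have := List.all_eq_true.1 hd d.val (List.mem_range.2 d.isLt)
    rw [Bool.or_eq_true, Nat.beq_eq, Nat.beq_eq] at this
    refine this.resolve_left fun h => hd0 ?_
    exact Fin.ext (by simpa using h)
  · intro t ht t' ht' s s' x hx y hy
    subst hK
    by_cases hc : (baseBlk t s).countP (fun z => z - x + y ∈ baseBlk t' s') ≤ 2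
    · exact Or.inr hc
    left
    rw [List.countP_eq_length_filter,
      ← List.toFinset_card_of_nodup ((hbase t ht s).filter _)] at hc
    have hc' : 1 < ((((baseBlk t s).filter
        (fun z => z - x + y ∈ baseBlk t' s')).toFinset).erase x).card := by
      have := Finset.pred_card_le_card_erase (a := x) (s := ((baseBlk t s).filter
        (fun z => z - x + y ∈ baseBlk t' s')).toFinset)
      omega
    obtain ⟨z, hz, w, hw, hzw⟩ := Finset.one_lt_card.1 hc'
    simp only [Finset.mem_erase, List.mem_toFinset, List.mem_filter, decide_eq_true_eq] at hz hw
    obtain ⟨hzx, hz1, hz2⟩ := hz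
    obtain ⟨hwx, hw1, hw2⟩ := hw
    have m1 := mem_configs (mem_natBlocks ht s) (List.mem_map_of_mem hx)
      (List.mem_map_of_mem hz1) (List.mem_map_of_mem hw1)
      (fun h => hzx (Fin.ext h).symm) (fun h => hwx (Fin.ext h).symm) (fun h => hzw (Fin.ext h))
    have m2 := mem_configs (mem_natBlocks ht' s') (List.mem_map_of_mem hy)
      (List.mem_map_of_mem hz2) (List.mem_map_of_mem hw2)
      (fun h => hzx (by
        have h' : z - x + y = 0 + y := by rw [zero_add]; exact (Fin.ext h).symm
        exact sub_eq_zero.1 (add_right_cancel h')))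
      (fun h => hwx (by
        have h' : w - x + y = 0 + y := by rw [zero_add]; exact (Fin.ext h).symm
        exact sub_eq_zero.1 (add_right_cancel h')))
      (fun h => hzw (sub_left_injective (add_right_cancel (Fin.ext h))))
    have hcode := List.inj_on_of_nodup_map (nodupMask_spec _ _ hi).1 m1 m2 (by
      simp only [code, ← val_diff, add_sub_cancel_right])
    simp only [Prod.mk.injEq] at hcode
    have h6 := (List.map_injective_iff.2 Fin.val_injective) hcode.1
    obtain ⟨e1, e2⟩ := baseBlk_inj (hbase t ht s) h6
    exact ⟨e1, e2, Fin.ext hcode.2.1⟩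

end Bridge

def list115 : List (ℕ × ℕ × ℕ) :=
  [(93,83,81),(63,84,77),(91,3,43),(65,86,85),(53,19,9),(1,76,111),(12,39,16),(92,79,54),
   (90,5,46),(113,98,55),(101,28,31),(24,6,69),(59,106,8),(33,99,41),(100,11,18),(86,51,19),
   (13,60,66),(22,95,59),(50,61,87)]

def list133 : List (ℕ × ℕ × ℕ) :=
  [(20,85,73),(25,72,48),(69,9,63),(80,59,29),(56,46,89),(120,71,93),(25,62,119),(5,103,36),
   (28,67,6),(43,15,131),(3,132,98),(116,42,107),(104,55,58),(129,118,110),(121,119,132),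
   (42,76,69),(78,47,88),(107,89,126),(92,52,36),(100,21,5),(32,82,24),(83,115,63)]

def blocks115 : List (List ℕ) :=
  [[0, 93, 83, 81], [93, 0, 10, 12], [0, 63, 84, 77], [63, 0, 94, 101],
   [0, 91, 3, 43], [91, 0, 88, 48], [0, 65, 86, 85], [65, 0, 94, 95],
   [0, 53, 19, 9], [53, 0, 34, 44], [0, 1, 76, 111], [1, 0, 40, 5],
   [0, 12, 39, 16], [12, 0, 88, 111], [0, 92, 79, 54], [92, 0, 13, 38],
   [0, 90, 5, 46], [90, 0, 85, 44], [0, 113, 98, 55], [113, 0, 15, 58],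
   [0, 101, 28, 31], [101, 0, 73, 70], [0, 24, 6, 69], [24, 0, 18, 70],
   [0, 59, 106, 8], [59, 0, 68, 51], [0, 33, 99, 41], [33, 0, 49, 107],
   [0, 100, 11, 18], [100, 0, 89, 82], [0, 86, 51, 19], [86, 0, 35, 67],
   [0, 13, 60, 66], [13, 0, 68, 62], [0, 22, 95, 59], [22, 0, 42, 78],
   [0, 50, 61, 87], [50, 0, 104, 78]]

def blocks133 : List (List ℕ) :=
  [[0, 20, 85, 73], [20, 0, 68, 80], [0, 25, 72, 48], [25, 0, 86, 110],
   [0, 69, 9, 63], [69, 0, 60, 6], [0, 80, 59, 29], [80, 0, 21, 51],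
   [0, 56, 46, 89], [56, 0, 10, 100], [0, 120, 71, 93], [120, 0, 49, 27],
   [0, 25, 62, 119], [25, 0, 96, 39], [0, 5, 103, 36], [5, 0, 35, 102],
   [0, 28, 67, 6], [28, 0, 94, 22], [0, 43, 15, 131], [43, 0, 28, 45],
   [0, 3, 132, 98], [3, 0, 4, 38], [0, 116, 42, 107], [116, 0, 74, 9],
   [0, 104, 55, 58], [104, 0, 49, 46], [0, 129, 118, 110], [129, 0, 11, 19],
   [0, 121, 119, 132], [121, 0, 2, 122], [0, 42, 76, 69], [42, 0, 99, 106],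
   [0, 78, 47, 88], [78, 0, 31, 123], [0, 107, 89, 126], [107, 0, 18, 114],
   [0, 92, 52, 36], [92, 0, 40, 56], [0, 100, 21, 5], [100, 0, 79, 95],
   [0, 32, 82, 24], [32, 0, 83, 8], [0, 83, 115, 63], [83, 0, 101, 20]]

theorem diff115 : diffCheck 115 blocks115 = true := by decide +kernel

theorem inter115 : interCheck 115 blocks115 = true := by decide +kernel

theorem diff133 : diffCheck 133 blocks133 = true := by decide +kernel

theorem inter133 : interCheck 133 blocks133 = true := by decide +kernel

theorem good115 : Good (toTriples 115 list115) :=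
  good_of_check (K := blocks115) (by decide +kernel) (by decide +kernel) (by decide +kernel)
    diff115 inter115

theorem good133 : Good (toTriples 133 list133) :=
  good_of_check (K := blocks133) (by decide +kernel) (by decide +kernel) (by decide +kernel)
    diff133 inter133

/-- For every `v` in the given set there exists a super-simple
`2-(v,4,2)` directed design in which every defining set contains at least
half of the blocks. -/
theorem exists_superSimple_DD_half_lemma16 (v : ℕ)
    (hv : v ∈ ({115, 133} : Finset ℕ)) :
    ∃ D : DirectedDesign (Fin v) 2 4 2, D.SuperSimple ∧ D.DefiningHalf := by
  simp only [Finset.mem_insert, Finset.mem_singleton] at hv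
  rcases hv with rfl | rfl
  · exact ⟨good115.design, good115.superSimple, good115.definingHalf⟩
  · exact ⟨good133.design, good133.superSimple, good133.definingHalf⟩
end

section
/- Let m be a positive integer such that there exist 6 mutually orthogonal Latin squares of order m (i.e., N(m) ≥ 6), and let a, b be integers with 0 ≤ a ≤ m and 0 ≤ b ≤ m. If for each v ∈ {3m + 1, 3a + 1, 3b + 1} there exists a super-simple 2-(v,4,2) directed design whose every defining set contains at least half of the blocks, then there exists a super-simple 2-(18m + 3a + 3b + 1, 4, 2) directed design whose every defining set contains at least half of the blocks. -/
/-- A Latin square of order `m`, given as a function `Fin m → Fin m → Fin m`: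
each row and each column is a bijection. -/
def IsLatinSquare {m : ℕ} (f : Fin m → Fin m → Fin m) : Prop :=
  (∀ i, Function.Bijective (f i)) ∧ (∀ j, Function.Bijective (fun i => f i j))

/-- A family of `r` mutually orthogonal Latin squares of order `m`. -/
def AreMOLS {m r : ℕ} (f : Fin r → Fin m → Fin m → Fin m) : Prop :=
  (∀ s, IsLatinSquare (f s)) ∧
    ∀ s t, s ≠ t →
      Function.Injective (fun p : Fin m × Fin m => (f s p.1 p.2, f t p.1 p.2))


/-- Number of blocks of `B` in which `x` precedes `y`. -/
def cov {X : Type*} [DecidableEq X] (B : Multiset (List X)) (x y : X) : ℕ :=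
  B.countP (fun b => [x, y].Sublist b)

/-- All blocks are duplicate-free quadruples. -/
def Reg {X : Type*} (B : Multiset (List X)) : Prop :=
  ∀ b ∈ B, b.length = 4 ∧ b.Nodup

/-- A super-simple collection of directed quadruples covering exactly the
ordered pairs of distinct points satisfying `P`, twice each, such that each
set determining it among the collections with the same coverage contains at
least half of the blocks. -/
structure Good_s16 {X : Type*} [DecidableEq X] (B : Finset (List X)) (P : X → X → Prop) : Prop where
  reg : Reg B.val
  cov_pos : ∀ x y, x ≠ y → P x y → cov B.val x y = 2
  cov_zero : ∀ x y, x ≠ y → ¬ P x y → cov B.val x y = 0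
  ss : ∀ b₁ ∈ B, ∀ b₂ ∈ B, b₁ ≠ b₂ → (b₁.toFinset ∩ b₂.toFinset).card ≤ 2
  half : ∀ S ⊆ B, (∀ B' : Multiset (List X), Reg B' →
    (∀ x y, x ≠ y → cov B' x y = cov B.val x y) → S.val ≤ B' → B' = B.val) →
    B.card ≤ 2 * S.card

theorem cov_add {X : Type*} [DecidableEq X] (A B : Multiset (List X)) (x y : X) :
    cov (A + B) x y = cov A x y + cov B x y := Multiset.countP_add _ _ _

theorem cov_sum {X ι : Type*} [DecidableEq X] (s : Finset ι) (B : ι → Multiset (List X))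
    (x y : X) : cov (∑ i ∈ s, B i) x y = ∑ i ∈ s, cov (B i) x y := by
  classical
  induction s using Finset.induction_on with
  | empty => simp [cov]
  | insert i s hi ih => rw [Finset.sum_insert hi, Finset.sum_insert hi, cov_add, ih]

theorem map_sublist_inj {X Y : Type*} {φ : X → Y} (hφ : Function.Injective φ)
    {l₁ l₂ : List X} : (l₁.map φ).Sublist (l₂.map φ) ↔ l₁.Sublist l₂ := by
  constructor
  · intro h
    obtain ⟨l, hl, e⟩ := List.sublist_map_iff.1 h
    rw [List.map_injective_iff.2 hφ e]
    exact hl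
  · exact fun h => h.map φ

theorem cov_map {X Y : Type*} [DecidableEq X] [DecidableEq Y] (φ : X → Y)
    (hφ : Function.Injective φ) (B : Multiset (List X)) (x y : X) :
    cov (B.map (List.map φ)) (φ x) (φ y) = cov B x y := by
  unfold cov
  rw [Multiset.countP_map, Multiset.countP_eq_card_filter]
  congr 1
  apply Multiset.filter_congr
  intro b _
  have := map_sublist_inj (l₁ := [x, y]) (l₂ := b) hφ
  simpa using this

theorem cov_map_zero {X Y : Type*} [DecidableEq Y] (φ : X → Y)
    (B : Multiset (List X)) (x y : Y)
    (h : ¬ (x ∈ Set.range φ ∧ y ∈ Set.range φ)) :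
    cov (B.map (List.map φ)) x y = 0 := by
  unfold cov
  rw [Multiset.countP_eq_zero]
  intro b hb hs
  obtain ⟨b, -, rfl⟩ := Multiset.mem_map.1 hb
  have h1 : x ∈ b.map φ := hs.subset (by simp)
  have h2 : y ∈ b.map φ := hs.subset (by simp)
  simp only [List.mem_map] at h1 h2
  exact h ⟨⟨_, h1.choose_spec.2⟩, ⟨_, h2.choose_spec.2⟩⟩

theorem Reg.map {X Y : Type*} {φ : X → Y} (hφ : Function.Injective φ) {B : Multiset (List X)}
    (h : Reg B) : Reg (B.map (List.map φ)) := by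
  intro b hb
  obtain ⟨c, hc, rfl⟩ := Multiset.mem_map.1 hb
  exact ⟨by simp [(h c hc).1], (h c hc).2.map hφ⟩

theorem Good_s16.map {X Y : Type*} [DecidableEq X] [DecidableEq Y] {B : Finset (List X)}
    {P : X → X → Prop} (h : Good_s16 B P) (φ : X → Y) (hφ : Function.Injective φ)
    (P' : Y → Y → Prop) (h1 : ∀ a b, P' (φ a) (φ b) ↔ P a b)
    (h2 : ∀ x y, P' x y → x ∈ Set.range φ ∧ y ∈ Set.range φ) :
    Good_s16 (B.map ⟨List.map φ, List.map_injective_iff.2 hφ⟩) P' where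
  reg := h.reg.map hφ
  cov_pos := by
    intro x y hxy hP
    obtain ⟨⟨a, rfl⟩, ⟨b, rfl⟩⟩ := h2 x y hP
    simp only [Finset.map_val, Function.Embedding.coeFn_mk]
    rw [cov_map φ hφ]
    exact h.cov_pos a b (fun e => hxy (e ▸ rfl)) ((h1 a b).1 hP)
  cov_zero := by
    intro x y hxy hP
    simp only [Finset.map_val, Function.Embedding.coeFn_mk]
    by_cases hr : x ∈ Set.range φ ∧ y ∈ Set.range φ
    · obtain ⟨⟨a, rfl⟩, ⟨b, rfl⟩⟩ := hr
      rw [cov_map φ hφ]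
      exact h.cov_zero a b (fun e => hxy (e ▸ rfl)) (fun hh => hP ((h1 a b).2 hh))
    · exact cov_map_zero φ _ x y hr
  ss := by
    intro b₁ hb₁ b₂ hb₂ hne
    simp only [Finset.mem_map, Function.Embedding.coeFn_mk] at hb₁ hb₂
    obtain ⟨c₁, hc₁, rfl⟩ := hb₁
    obtain ⟨c₂, hc₂, rfl⟩ := hb₂
    have := h.ss c₁ hc₁ c₂ hc₂ (fun e => hne (e ▸ rfl))
    have e : ∀ c : List X, (c.map φ).toFinset = c.toFinset.image φ := by
      intro c; ext z; simp
    rw [e, e, ← Finset.image_inter _ _ hφ, Finset.card_image_of_injective _ hφ]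
    exact this
  half := by
    intro S hS hdef
    obtain ⟨T, hT, rfl⟩ := Finset.subset_map_iff.1 hS
    rw [Finset.card_map, Finset.card_map]
    apply h.half T hT
    intro B' hreg hcov hle
    have key := hdef (B'.map (List.map φ)) (hreg.map hφ) ?_ ?_
    · simp only [Finset.map_val, Function.Embedding.coeFn_mk] at key
      exact Multiset.map_injective (List.map_injective_iff.2 hφ) key
    · intro x y hxy
      simp only [Finset.map_val, Function.Embedding.coeFn_mk]
      by_cases hr : x ∈ Set.range φ ∧ y ∈ Set.range φ
      · obtain ⟨⟨a, rfl⟩, ⟨b, rfl⟩⟩ := hr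
        rw [cov_map φ hφ, cov_map φ hφ]
        exact hcov a b (fun e => hxy (e ▸ rfl))
      · rw [cov_map_zero φ _ x y hr, cov_map_zero φ _ x y hr]
    · simp only [Finset.map_val, Function.Embedding.coeFn_mk]
      exact Multiset.map_le_map hle

theorem pair_sublist_or {X : Type*} {x y : X} (hxy : x ≠ y) :
    ∀ {b : List X}, x ∈ b → y ∈ b → [x, y].Sublist b ∨ [y, x].Sublist b
  | [], hx, _ => by simp at hx
  | z :: b, hx, hy => by
    rcases List.mem_cons.1 hx with rfl | hx'
    · left
      have hy' : y ∈ b := by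
        rcases List.mem_cons.1 hy with rfl | h
        · exact absurd rfl hxy
        · exact h
      simpa using hy'
    · rcases List.mem_cons.1 hy with rfl | hy'
      · right
        simpa using hx'
      · rcases pair_sublist_or hxy hx' hy' with h | h
        · exact Or.inl (h.cons _)
        · exact Or.inr (h.cons _)

theorem Good_s16.mem_pair {X : Type*} [DecidableEq X] {B : Finset (List X)}
    {P : X → X → Prop} (h : Good_s16 B P) (hs : ∀ x y, P x y → P y x) {b : List X} (hb : b ∈ B)
    {x y : X} (hxy : x ≠ y) (hx : x ∈ b) (hy : y ∈ b) : P x y := by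
  have aux : ∀ x y, x ≠ y → [x, y].Sublist b → P x y := by
    intro x y hxy hsub
    by_contra hP
    have := h.cov_zero x y hxy hP
    unfold cov at this
    rw [Multiset.countP_eq_zero] at this
    exact this b hb hsub
  rcases pair_sublist_or hxy hx hy with h1 | h1
  · exact aux x y hxy h1
  · exact hs _ _ (aux y x hxy.symm h1)

theorem Good_s16.sum {X ι : Type*} [DecidableEq X] [Fintype ι] [DecidableEq ι]
    (B : ι → Finset (List X)) (P : ι → X → X → Prop) (h : ∀ i, Good_s16 (B i) (P i))
    (hs : ∀ i x y, P i x y → P i y x)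
    (hex : ∀ x y, x ≠ y → ∃ i, P i x y)
    (huniq : ∀ x y, x ≠ y → ∀ i j, P i x y → P j x y → i = j) :
    Good_s16 (Finset.univ.biUnion B) (fun _ _ => True) := by
  have hcross : ∀ i j, i ≠ j → ∀ b₁ ∈ B i, ∀ b₂ ∈ B j,
      (b₁.toFinset ∩ b₂.toFinset).card ≤ 1 := by
    intro i j hij b₁ hb₁ b₂ hb₂
    rw [Finset.card_le_one]
    intro x hx y hy
    by_contra hxy
    simp only [Finset.mem_inter, List.mem_toFinset] at hx hy
    exact hij (huniq x y hxy i j ((h i).mem_pair (hs i) hb₁ hxy hx.1 hy.1)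
      ((h j).mem_pair (hs j) hb₂ hxy hx.2 hy.2))
  have hdisj : ∀ i j, i ≠ j → Disjoint (B i) (B j) := by
    intro i j hij
    rw [Finset.disjoint_left]
    intro b hb hb'
    have h1 := hcross i j hij b hb b hb'
    rw [Finset.inter_self, List.toFinset_card_of_nodup ((h i).reg b hb).2,
      ((h i).reg b hb).1] at h1
    omega
  have hval : (Finset.univ.biUnion B).val = ∑ i, (B i).val := by
    have e1 : Finset.univ.biUnion B = Finset.univ.disjiUnion B
        (fun i _ j _ hij => hdisj i j hij) := by
      exact (Finset.disjiUnion_eq_biUnion _ _ _).symm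
    rw [e1]
    rfl
  have hcov : ∀ x y, x ≠ y → ∀ i, P i x y →
      cov (Finset.univ.biUnion B).val x y = 2 := by
    intro x y hxy i hi
    rw [hval, cov_sum, Finset.sum_eq_single i, (h i).cov_pos x y hxy hi]
    · intro j _ hj
      exact (h j).cov_zero x y hxy (fun hP => hj (huniq x y hxy j i hP hi))
    · simp
  refine ⟨?_, ?_, ?_, ?_, ?_⟩
  · intro b hb
    obtain ⟨i, -, hi⟩ := Finset.mem_biUnion.1 (show b ∈ Finset.univ.biUnion B from hb)
    exact (h i).reg b hi
  · intro x y hxy _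
    obtain ⟨i, hi⟩ := hex x y hxy
    exact hcov x y hxy i hi
  · intro x y _ hh
    exact absurd trivial hh
  · intro b₁ hb₁ b₂ hb₂ hne
    obtain ⟨i, -, hi⟩ := Finset.mem_biUnion.1 hb₁
    obtain ⟨j, -, hj⟩ := Finset.mem_biUnion.1 hb₂
    by_cases hij : i = j
    · subst hij
      exact (h i).ss _ hi _ hj hne
    · exact (hcross i j hij _ hi _ hj).trans (by norm_num)
  · intro S hS hdef
    have hpart : ∀ i, (B i).card ≤ 2 * (S ∩ B i).card := by
      intro i
      apply (h i).half _ Finset.inter_subset_right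
      intro B' hreg hc hle
      have hsplit : ∑ j, (B j).val = (B i).val + ∑ j ∈ Finset.univ.erase i, (B j).val :=
        (Finset.add_sum_erase _ _ (Finset.mem_univ i)).symm
      have key := hdef (B' + ∑ j ∈ Finset.univ.erase i, (B j).val) ?_ ?_ ?_
      · rw [hval, hsplit] at key
        exact add_right_cancel key
      · intro b hb
        rcases Multiset.mem_add.1 hb with hb | hb
        · exact hreg b hb
        · obtain ⟨j, -, hj⟩ := Multiset.mem_sum.1 hb
          exact (h j).reg b hj
      · intro x y hxy
        rw [hval, hsplit, cov_add, cov_add, hc x y hxy]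
      · rw [Multiset.le_iff_subset S.nodup]
        intro b hb
        obtain ⟨j, -, hj⟩ := Finset.mem_biUnion.1 (hS hb)
        rw [Multiset.mem_add]
        by_cases hij : j = i
        · subst hij
          left
          exact Multiset.mem_of_le hle (Finset.mem_inter.2 ⟨hb, hj⟩)
        · right
          exact Multiset.mem_sum.2 ⟨j, by simp [hij], hj⟩
    rw [Finset.card_biUnion (fun i _ j _ hij => hdisj i j hij)]
    calc ∑ i, (B i).card ≤ ∑ i, 2 * (S ∩ B i).card := Finset.sum_le_sum (fun i _ => hpart i)
      _ = 2 * (Finset.univ.biUnion (fun i => S ∩ B i)).card := by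
        rw [← Finset.mul_sum, Finset.card_biUnion]
        intro i _ j _ hij
        exact Finset.disjoint_of_subset_left Finset.inter_subset_right
          (Finset.disjoint_of_subset_right Finset.inter_subset_right (hdisj i j hij))
      _ ≤ 2 * S.card := by
        apply Nat.mul_le_mul_left
        apply Finset.card_le_card
        intro b hb
        obtain ⟨i, -, hi⟩ := Finset.mem_biUnion.1 hb
        exact (Finset.mem_inter.1 hi).1

theorem Good_s16.of_design {X : Type*} [DecidableEq X] (D : DirectedDesign X 2 4 2)
    (h1 : D.SuperSimple) (h2 : D.DefiningHalf) :
    Good_s16 ⟨D.blocks, h1.1⟩ (fun _ _ : X => True) where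
  reg := fun b hb => ⟨D.len b hb, D.nodup b hb⟩
  cov_pos := fun x y hxy _ => D.covers [x, y] rfl (by simp [hxy])
  cov_zero := fun _ _ _ hh => absurd trivial hh
  ss := h1.2
  half := by
    intro S hS hdef
    refine h2 S.val ⟨Finset.val_le_iff.2 hS, ?_⟩
    intro D' hD'
    refine hdef D'.blocks (fun b hb => ⟨D'.len b hb, D'.nodup b hb⟩) ?_ hD'
    intro x y hxy
    exact (D'.covers [x, y] rfl (by simp [hxy])).trans
      (D.covers [x, y] rfl (by simp [hxy])).symm

theorem Good_s16.to_design {X : Type*} [DecidableEq X] {B : Finset (List X)} {P : X → X → Prop}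
    (h : Good_s16 B P) (hP : ∀ x y, x ≠ y → P x y) :
    ∃ D : DirectedDesign X 2 4 2, D.SuperSimple ∧ D.DefiningHalf := by
  let D : DirectedDesign X 2 4 2 :=
    { blocks := B.val
      len := fun b hb => (h.reg b hb).1
      nodup := fun b hb => (h.reg b hb).2
      covers := by
        intro s hs hn
        obtain ⟨x, y, rfl⟩ := List.length_eq_two.1 hs
        have hxy : x ≠ y := by simpa using hn
        exact h.cov_pos x y hxy (hP x y hxy) }
  refine ⟨D, ⟨B.nodup, h.ss⟩, ?_⟩
  intro S hS
  have hn : S.Nodup := Multiset.nodup_of_le hS.1 B.nodup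
  refine h.half ⟨S, hn⟩ (Finset.val_le_iff.1 hS.1) ?_
  intro B' hreg hc hle
  let D' : DirectedDesign X 2 4 2 :=
    { blocks := B'
      len := fun b hb => (hreg b hb).1
      nodup := fun b hb => (hreg b hb).2
      covers := by
        intro s hs hn
        obtain ⟨x, y, rfl⟩ := List.length_eq_two.1 hs
        have hxy : x ≠ y := by simpa using hn
        exact (hc x y hxy).trans (h.cov_pos x y hxy (hP x y hxy)) }
  exact hS.2 D' hle

/-- The `s`-translate of the `i`-th base block. -/
def tblock {G : Type*} [AddCommGroup G] {k : ℕ} (base : Fin k → List G) (p : Fin k × G) :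
    List G := (base p.1).map (· + p.2)

theorem cyclic_good {G : Type*} [AddCommGroup G] [Fintype G] [DecidableEq G] {k : ℕ}
    (base c₁ c₂ : Fin k → List G) (π : Fin k → Fin k) (t : Fin k → G) (H : G → Prop)
    (hlen : ∀ i, (base i).length = 4 ∧ (base i).Nodup)
    (hlen₁ : ∀ i, (c₁ i).length = 4 ∧ (c₁ i).Nodup)
    (hlen₂ : ∀ i, (c₂ i).length = 4 ∧ (c₂ i).Nodup)
    (hcov : ∀ d, d ≠ 0 → (H d → ∑ i, ∑ s, (if [0, d].Sublist (tblock base (i, s)) then 1 else 0) = 2)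
      ∧ (¬ H d → ∑ i, ∑ s, (if [0, d].Sublist (tblock base (i, s)) then 1 else 0) = 0))
    (hss : ∀ i j s, (i = j ∧ s = 0) ∨
      ((base i).toFinset ∩ (tblock base (j, s)).toFinset).card ≤ 2)
    (hπ : Function.Injective π)
    (hne : ∀ i, ¬ (π i = i ∧ t i = 0))
    (hc : ∀ i, c₁ i ≠ base i ∧ c₁ i ≠ tblock base (π i, t i))
    (hsub : ∀ i, ∀ z ∈ c₁ i ++ c₂ i, z ∈ base i ++ tblock base (π i, t i))
    (htr' : ∀ i, ∀ x ∈ base i ++ tblock base (π i, t i),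
      ∀ y ∈ base i ++ tblock base (π i, t i), x ≠ y →
      cov {base i, tblock base (π i, t i)} x y = cov {c₁ i, c₂ i} x y) :
    ∃ B : Finset (List G), Good_s16 B (fun x y => H (y - x)) := by
  classical
  have htr : ∀ i x y, x ≠ y →
      cov {base i, tblock base (π i, t i)} x y = cov {c₁ i, c₂ i} x y := by
    intro i x y hxy
    by_cases h : x ∈ base i ++ tblock base (π i, t i) ∧ y ∈ base i ++ tblock base (π i, t i)
    · exact htr' i x h.1 y h.2 hxy
    · have hzero : ∀ l₁ l₂ : List G,
          (∀ z ∈ l₁ ++ l₂, z ∈ base i ++ tblock base (π i, t i)) → cov {l₁, l₂} x y = 0 := by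
        intro l₁ l₂ hl
        unfold cov
        rw [Multiset.countP_eq_zero]
        intro l hl' hs
        have hll : ∀ z ∈ l, z ∈ l₁ ++ l₂ := by
          intro z hz
          simp only [Multiset.insert_eq_cons, Multiset.mem_cons, Multiset.mem_singleton] at hl'
          rcases hl' with rfl | rfl
          · exact List.mem_append_left _ hz
          · exact List.mem_append_right _ hz
        exact h ⟨hl _ (hll _ (hs.subset (by simp))), hl _ (hll _ (hs.subset (by simp)))⟩
      rw [hzero _ _ (fun z hz => hz), hzero _ _ (hsub i)]
  have hadd : ∀ s : G, Function.Injective (fun x : G => x + s) := fun s => add_left_injective s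
  have htt : ∀ i s u, (tblock base (i, s)).map (· + u) = tblock base (i, s + u) := by
    intro i s u
    simp [tblock, Function.comp_def, add_assoc]
  have hlt : ∀ p, (tblock base p).length = 4 ∧ (tblock base p).Nodup := fun p =>
    ⟨by simp [tblock, hlen], (hlen p.1).2.map (hadd _)⟩
  -- intersections
  have hint : ∀ p q : Fin k × G, p ≠ q →
      ((tblock base p).toFinset ∩ (tblock base q).toFinset).card ≤ 2 := by
    rintro ⟨i, s⟩ ⟨j, u⟩ hpq
    have h0 : ((base i).toFinset ∩ (tblock base (j, u - s)).toFinset).card ≤ 2 := by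
      rcases hss i j (u - s) with h | h
      · exact absurd (by rw [h.1, sub_eq_zero.1 h.2]) hpq
      · exact h
    have e : ∀ c : List G, (c.map (· + s)).toFinset = c.toFinset.image (· + s) := by
      intro c; ext z; simp only [List.mem_toFinset, List.mem_map, Finset.mem_image]
    have e2 : tblock base (j, u) = (tblock base (j, u - s)).map (· + s) := by
      rw [htt, sub_add_cancel]
    have e1 : tblock base (i, s) = (base i).map (· + s) := rfl
    rw [e1, e2, e, e, ← Finset.image_inter _ _ (hadd s),
      Finset.card_image_of_injective _ (hadd s)]
    exact h0
  have hinj : Function.Injective (tblock base) := by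
    intro p q hpq
    by_contra hne
    have := hint p q hne
    rw [hpq, Finset.inter_self, List.toFinset_card_of_nodup (hlt q).2, (hlt q).1] at this
    omega
  let B : Finset (List G) := Finset.univ.map ⟨tblock base, hinj⟩
  have hmem : ∀ b, b ∈ B ↔ ∃ p, tblock base p = b := by
    intro b; simp [B]
  have hcovB : ∀ x y, cov B.val x y =
      ∑ i, ∑ s, (if [0, y - x].Sublist (tblock base (i, s)) then 1 else 0) := by
    intro x y
    have h1 : cov B.val x y = ∑ p : Fin k × G, (if [x, y].Sublist (tblock base p) then 1 else 0) := by
      simp only [cov, B, Finset.map_val, Function.Embedding.coeFn_mk]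
      rw [Multiset.countP_map, Finset.sum_boole]
      rfl
    rw [h1, Fintype.sum_prod_type]
    apply Finset.sum_congr rfl
    intro i _
    rw [← Equiv.sum_comp (Equiv.addRight x)]
    apply Finset.sum_congr rfl
    intro s _
    have h2 := map_sublist_inj (l₁ := [0, y - x]) (l₂ := tblock base (i, s)) (hadd x)
    rw [htt] at h2
    simp only [List.map_cons, List.map_nil, zero_add, sub_add_cancel] at h2
    simp only [Equiv.coe_addRight, h2]
  refine ⟨B, ⟨?_, ?_, ?_, ?_, ?_⟩⟩
  · intro b hb
    obtain ⟨p, rfl⟩ := (hmem b).1 hb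
    exact hlt p
  · intro x y hxy hH
    rw [hcovB]
    exact (hcov (y - x) (sub_ne_zero.2 hxy.symm)).1 hH
  · intro x y hxy hH
    rw [hcovB]
    exact (hcov (y - x) (sub_ne_zero.2 hxy.symm)).2 hH
  · intro b₁ hb₁ b₂ hb₂ hne
    obtain ⟨p, rfl⟩ := (hmem _).1 hb₁
    obtain ⟨q, rfl⟩ := (hmem _).1 hb₂
    exact hint p q (fun e => hne (e ▸ rfl))
  · intro S hS hdef
    let T : Finset (Fin k × G) := Finset.univ.filter (fun p => tblock base p ∈ S)
    let σ : Fin k × G → Fin k × G := fun p => (π p.1, t p.1 + p.2)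
    have hσ : Function.Injective σ := by
      rintro ⟨i, s⟩ ⟨j, u⟩ h
      simp only [σ, Prod.mk.injEq] at h
      have hij := hπ h.1
      subst hij
      simpa using h.2
    have hT : T.card ≤ S.card :=
      Finset.card_le_card_of_injOn (tblock base) (fun p hp => by simpa [T] using hp)
        hinj.injOn
    have hor : ∀ p, p ∈ T ∨ σ p ∈ T := by
      rintro ⟨i, s⟩
      by_contra hcon
      push Not at hcon
      obtain ⟨hp, hq⟩ := hcon
      simp only [T, σ, Finset.mem_filter, Finset.mem_univ, true_and] at hp hq
      have hpq : tblock base (i, s) ≠ tblock base (π i, t i + s) := by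
        intro e
        have e' := hinj e
        simp only [Prod.mk.injEq] at e'
        exact hne i ⟨e'.1.symm, by simpa using e'.2⟩
      let R : Finset (List G) := (B.erase (tblock base (i, s))).erase (tblock base (π i, t i + s))
      have hBR : B.val = {tblock base (i, s), tblock base (π i, t i + s)} + R.val := by
        have h1 : tblock base (π i, t i + s) ∈ B.erase (tblock base (i, s)) :=
          Finset.mem_erase.2 ⟨hpq.symm, (hmem _).2 ⟨_, rfl⟩⟩
        have h2 : tblock base (i, s) ∈ B := (hmem _).2 ⟨_, rfl⟩
        have h3 : (B.erase (tblock base (i, s))).val = tblock base (π i, t i + s) ::ₘ R.val := by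
          simp only [R, Finset.erase_val]
          exact (Multiset.cons_erase h1).symm
        have h4 : B.val = tblock base (i, s) ::ₘ (B.erase (tblock base (i, s))).val := by
          simp only [Finset.erase_val]
          exact (Multiset.cons_erase h2).symm
        rw [h4, h3]
        simp [Multiset.insert_eq_cons]
      have key := hdef ({(c₁ i).map (· + s), (c₂ i).map (· + s)} + R.val) ?_ ?_ ?_
      · rw [hBR] at key
        have key2 := add_right_cancel key
        have h5 : (c₁ i).map (· + s) ∈
            ({tblock base (i, s), tblock base (π i, t i + s)} : Multiset (List G)) := by
          rw [← key2]; simp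
        have hm := List.map_injective_iff.2 (hadd s)
        simp only [Multiset.insert_eq_cons, Multiset.mem_cons, Multiset.mem_singleton] at h5
        rcases h5 with h5 | h5
        · exact (hc i).1 (hm h5)
        · rw [← htt] at h5
          exact (hc i).2 (hm h5)
      · intro b hb
        simp only [Multiset.insert_eq_cons, Multiset.mem_add, Multiset.mem_cons,
          Multiset.mem_singleton] at hb
        rcases hb with (rfl | rfl) | hb
        · exact ⟨by simp [hlen₁], (hlen₁ i).2.map (hadd s)⟩
        · exact ⟨by simp [hlen₂], (hlen₂ i).2.map (hadd s)⟩
        · have hb' : b ∈ B := Finset.mem_of_mem_erase (Finset.mem_of_mem_erase hb)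
          obtain ⟨p, rfl⟩ := (hmem b).1 hb'
          exact hlt p
      · intro x y hxy
        rw [hBR, cov_add, cov_add]
        congr 1
        have h6 := htr i (x - s) (y - s) (fun e => hxy (sub_left_injective e))
        have h7 := cov_map (· + s) (hadd s) {base i, tblock base (π i, t i)} (x - s) (y - s)
        have h8 := cov_map (· + s) (hadd s) {c₁ i, c₂ i} (x - s) (y - s)
        simp only [sub_add_cancel, Multiset.insert_eq_cons, Multiset.map_cons,
          Multiset.map_singleton, htt] at h6 h7 h8 ⊢
        rw [h8, ← h6, ← h7]
        rfl
      · rw [Multiset.le_iff_subset S.nodup]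
        intro b hb
        rw [Multiset.mem_add]
        right
        have hbB := hS hb
        show b ∈ R
        simp only [R, Finset.mem_erase]
        exact ⟨fun e => hq (e ▸ hb), fun e => hp (e ▸ hb), hbB⟩
    have hcard : (Finset.univ : Finset (Fin k × G)).card ≤ T.card + T.card := by
      calc (Finset.univ : Finset (Fin k × G)).card
          ≤ (T ∪ Finset.univ.filter (fun p => σ p ∈ T)).card := by
            apply Finset.card_le_card
            intro p _
            simpa using hor p
        _ ≤ T.card + (Finset.univ.filter (fun p => σ p ∈ T)).card := Finset.card_union_le _ _
        _ ≤ T.card + T.card := by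
            apply Nat.add_le_add_left
            exact Finset.card_le_card_of_injOn σ (fun p hp => by simpa using hp) hσ.injOn
    have hBc : B.card = (Finset.univ : Finset (Fin k × G)).card := by simp [B]
    omega

theorem dgdd_6_cyclic : ∃ B : Finset (List (ZMod 18)),
    Good_s16 B (fun x y => (y - x).val % 6 ≠ 0) :=
  cyclic_good (k := 5) (H := fun d : ZMod 18 => d.val % 6 ≠ 0)
    ![[0, 14, 9, 1], [0, 2, 1, 16], [0, 2, 11, 15], [0, 16, 5, 8], [0, 8, 7, 11]]
    ![[14, 0, 9, 1], [2, 0, 1, 16], [0, 11, 2, 15], [16, 0, 5, 8], [8, 0, 7, 11]]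
    ![[7, 15, 0, 14], [0, 2, 7, 10], [9, 2, 11, 6], [0, 16, 17, 14], [17, 13, 0, 8]]
    ![4, 3, 2, 1, 0] ![7, 2, 9, 16, 17]
    (by decide +kernel) (by decide +kernel) (by decide +kernel) (by decide +kernel)
    (by decide +kernel) (by decide +kernel) (by decide +kernel) (by decide +kernel)
    (by decide +kernel) (by unfold cov; decide +kernel)

theorem dgdd_6 : ∃ B : Finset (List (Fin 6 × Fin 3)), Good_s16 B (fun x y => x.1 ≠ y.1) := by
  obtain ⟨B, hB⟩ := dgdd_6_cyclic
  let φ : ZMod 18 → Fin 6 × Fin 3 := fun x => (Fin.ofNat 6 (x.val % 6), Fin.ofNat 3 (x.val / 6))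
  have h1 : Function.Injective φ := by decide +kernel
  have h2 : ∀ z, z ∈ Set.range φ := by
    have : ∀ z, ∃ x, φ x = z := by decide +kernel
    exact this
  have h3 : ∀ a b, (φ a).1 ≠ (φ b).1 ↔ (b - a).val % 6 ≠ 0 := by decide +kernel
  exact ⟨_, hB.map φ h1 _ h3 (fun x y _ => ⟨h2 x, h2 y⟩)⟩

theorem dgdd_7_cyclic : ∃ B : Finset (List (ZMod 21)),
    Good_s16 B (fun x y => (y - x).val % 7 ≠ 0) :=
  cyclic_good (k := 6) (H := fun d : ZMod 21 => d.val % 7 ≠ 0)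
    ![[0, 16, 4, 5], [0, 1, 19, 10], [0, 17, 2, 20], [0, 2, 13, 8], [0, 12, 15, 20], [0, 13, 17, 11]]
    ![[0, 4, 16, 5], [0, 1, 10, 19], [17, 0, 2, 20], [0, 2, 8, 13], [0, 12, 20, 15], [0, 17, 13, 11]]
    ![[6, 7, 16, 4], [15, 19, 10, 20], [4, 0, 17, 15], [14, 5, 13, 8], [7, 9, 15, 20], [13, 17, 19, 16]]
    ![1, 0, 5, 4, 3, 2] ![6, 15, 4, 14, 7, 17]
    (by decide +kernel) (by decide +kernel) (by decide +kernel) (by decide +kernel)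
    (by decide +kernel) (by decide +kernel) (by decide +kernel) (by decide +kernel)
    (by decide +kernel) (by unfold cov; decide +kernel)

theorem dgdd_7 : ∃ B : Finset (List (Fin 7 × Fin 3)), Good_s16 B (fun x y => x.1 ≠ y.1) := by
  obtain ⟨B, hB⟩ := dgdd_7_cyclic
  let φ : ZMod 21 → Fin 7 × Fin 3 := fun x => (Fin.ofNat 7 (x.val % 7), Fin.ofNat 3 (x.val / 7))
  have h1 : Function.Injective φ := by decide +kernel
  have h2 : ∀ z, z ∈ Set.range φ := by
    have : ∀ z, ∃ x, φ x = z := by decide +kernel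
    exact this
  have h3 : ∀ a b, (φ a).1 ≠ (φ b).1 ↔ (b - a).val % 7 ≠ 0 := by decide +kernel
  exact ⟨_, hB.map φ h1 _ h3 (fun x y _ => ⟨h2 x, h2 y⟩)⟩

theorem dgdd_8_cyclic : ∃ B : Finset (List (ZMod 24)),
    Good_s16 B (fun x y => (y - x).val % 8 ≠ 0) :=
  cyclic_good (k := 7) (H := fun d : ZMod 24 => d.val % 8 ≠ 0)
    ![[0, 15, 1, 19], [0, 2, 3, 12], [0, 2, 13, 19], [0, 23, 5, 3], [0, 7, 12, 21], [0, 23, 13, 20], [0, 20, 18, 11]]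
    ![[15, 0, 1, 19], [0, 3, 2, 12], [2, 0, 13, 19], [0, 23, 3, 5], [0, 7, 21, 12], [0, 23, 20, 13], [0, 20, 11, 18]]
    ![[12, 14, 0, 15], [2, 3, 16, 23], [21, 20, 0, 2], [5, 3, 16, 22], [12, 21, 22, 16], [2, 22, 13, 20], [18, 11, 23, 8]]
    ![1, 5, 3, 2, 0, 6, 4] ![12, 3, 21, 3, 21, 2, 11]
    (by decide +kernel) (by decide +kernel) (by decide +kernel) (by decide +kernel)
    (by decide +kernel) (by decide +kernel) (by decide +kernel) (by decide +kernel)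
    (by decide +kernel) (by unfold cov; decide +kernel)

theorem dgdd_8 : ∃ B : Finset (List (Fin 8 × Fin 3)), Good_s16 B (fun x y => x.1 ≠ y.1) := by
  obtain ⟨B, hB⟩ := dgdd_8_cyclic
  let φ : ZMod 24 → Fin 8 × Fin 3 := fun x => (Fin.ofNat 8 (x.val % 8), Fin.ofNat 3 (x.val / 8))
  have h1 : Function.Injective φ := by decide +kernel
  have h2 : ∀ z, z ∈ Set.range φ := by
    have : ∀ z, ∃ x, φ x = z := by decide +kernel
    exact this
  have h3 : ∀ a b, (φ a).1 ≠ (φ b).1 ↔ (b - a).val % 8 ≠ 0 := by decide +kernel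
  exact ⟨_, hB.map φ h1 _ h3 (fun x y _ => ⟨h2 x, h2 y⟩)⟩

theorem dgdd_of_card {I : Type*} [Fintype I] [DecidableEq I]
    (h6 : 6 ≤ Fintype.card I) (h8 : Fintype.card I ≤ 8) :
    ∃ B : Finset (List (I × Fin 3)), Good_s16 B (fun x y => x.1 ≠ y.1) := by
  have aux : ∀ n, n = Fintype.card I →
      (∃ B : Finset (List (Fin n × Fin 3)), Good_s16 B (fun x y => x.1 ≠ y.1)) →
      ∃ B : Finset (List (I × Fin 3)), Good_s16 B (fun x y => x.1 ≠ y.1) := by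
    rintro n hn ⟨B, hB⟩
    let e : Fin n ≃ I := (Fintype.equivFinOfCardEq hn.symm).symm
    let φ : Fin n × Fin 3 ≃ I × Fin 3 := e.prodCongr (Equiv.refl _)
    refine ⟨_, hB.map φ φ.injective _ ?_ (fun x y _ => ⟨φ.surjective x, φ.surjective y⟩)⟩
    intro a b
    simp [φ]
  have : Fintype.card I = 6 ∨ Fintype.card I = 7 ∨ Fintype.card I = 8 := by omega
  rcases this with h | h | h
  · exact aux 6 h.symm dgdd_6
  · exact aux 7 h.symm dgdd_7
  · exact aux 8 h.symm dgdd_8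

/-- Wilson-type assembly on the point set `Option ((Σ i, Fin (sz i)) × Fin 3)`. -/
theorem assemble (m : ℕ) (sz : Fin 8 → ℕ) (hsz : ∀ i, sz i ≤ m)
    (hsz6 : ∀ i : Fin 8, i.val < 6 → sz i = m)
    (g : Fin 8 → Fin m × Fin m → Fin m)
    (hg : ∀ i j, i ≠ j → Function.Bijective (fun p => (g i p, g j p)))
    (hin : ∀ i, ∃ D : DirectedDesign (Fin (3 * sz i + 1)) 2 4 2,
      D.SuperSimple ∧ D.DefiningHalf) :
    ∃ B : Finset (List (Option ((Σ i, Fin (sz i)) × Fin 3))), Good_s16 B (fun _ _ => True) := by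
  classical
  -- the pairs covered by each piece
  let inG : Fin 8 → Option ((Σ i, Fin (sz i)) × Fin 3) → Prop :=
    fun i x => ∀ q, x = some q → q.1.1 = i
  let onB : Fin m × Fin m → (Σ i, Fin (sz i)) → Prop :=
    fun p q => (g q.1 p).val = q.2.val
  let P : Fin 8 ⊕ (Fin m × Fin m) → Option ((Σ i, Fin (sz i)) × Fin 3) →
      Option ((Σ i, Fin (sz i)) × Fin 3) → Prop := fun k x y =>
    match k with
    | Sum.inl i => inG i x ∧ inG i y
    | Sum.inr p => ∃ q q', x = some q ∧ y = some q' ∧ q.1.1 ≠ q'.1.1 ∧ onB p q.1 ∧ onB p q'.1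
  have hpieces : ∀ k, ∃ B : Finset (List (Option ((Σ i, Fin (sz i)) × Fin 3))), Good_s16 B (P k) := by
    rintro (i | p)
    · obtain ⟨D, h1, h2⟩ := hin i
      have hcard : Fintype.card (Option (Fin (sz i) × Fin 3)) = 3 * sz i + 1 := by
        simp; ring
      let e : Fin (3 * sz i + 1) ≃ Option (Fin (sz i) × Fin 3) :=
        (Fintype.equivFinOfCardEq hcard).symm
      let ψ : Option (Fin (sz i) × Fin 3) → Option ((Σ i, Fin (sz i)) × Fin 3) :=
        Option.map (fun r => (⟨i, r.1⟩, r.2))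
      have hψ : Function.Injective ψ := by
        apply Option.map_injective
        rintro ⟨r, s⟩ ⟨r', s'⟩ h
        simpa using h
      have hψG : ∀ z, inG i (ψ z) := by
        intro z q hq
        cases z with
        | none => simp [ψ] at hq
        | some r =>
          simp only [ψ, Option.map_some, Option.some.injEq] at hq
          rw [← hq]
      have hrange : ∀ x, inG i x → x ∈ Set.range (ψ ∘ e) := by
        intro x hx
        have : ∃ z, ψ z = x := by
          cases x with
          | none => exact ⟨none, rfl⟩
          | some q =>
            obtain ⟨⟨j, r⟩, s⟩ := q
            have hj : j = i := hx _ rfl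
            subst hj
            exact ⟨some (r, s), rfl⟩
        obtain ⟨z, hz⟩ := this
        exact ⟨e.symm z, by simp [hz]⟩
      refine ⟨_, (Good_s16.of_design D h1 h2).map (ψ ∘ e) (hψ.comp e.injective) (P (Sum.inl i)) ?_ ?_⟩
      · intro u v
        exact ⟨fun _ => trivial, fun _ => ⟨hψG _, hψG _⟩⟩
      · intro x y hxy
        exact ⟨hrange x hxy.1, hrange y hxy.2⟩
    · let I : Type := {i : Fin 8 // (g i p).val < sz i}
      have h8 : Fintype.card I ≤ 8 := by
        simpa using Fintype.card_subtype_le (fun i : Fin 8 => (g i p).val < sz i)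
      have h6 : 6 ≤ Fintype.card I := by
        have := Fintype.card_le_of_injective
          (fun i : Fin 6 => (⟨⟨i.val, by omega⟩, by
            rw [hsz6 _ i.isLt]; exact (g _ p).isLt⟩ : I)) (by
            intro i j hij
            simp only [Subtype.mk.injEq, Fin.mk.injEq] at hij
            exact Fin.ext hij)
        simpa using this
      obtain ⟨B, hB⟩ := dgdd_of_card h6 h8
      let ψ : I × Fin 3 → Option ((Σ i, Fin (sz i)) × Fin 3) :=
        fun z => some (⟨z.1.1, ⟨(g z.1.1 p).val, z.1.2⟩⟩, z.2)
      have hψ : Function.Injective ψ := by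
        rintro ⟨⟨i, hi⟩, s⟩ ⟨⟨j, hj⟩, s'⟩ h
        simp only [ψ, Option.some.injEq, Prod.mk.injEq, Sigma.mk.injEq] at h
        obtain ⟨⟨h1, -⟩, h2⟩ := h
        subst h1 h2
        rfl
      have hr : ∀ q : (Σ i, Fin (sz i)) × Fin 3, onB p q.1 → some q ∈ Set.range ψ := by
        rintro ⟨⟨j, r⟩, s⟩ hq
        have hq' : (g j p).val = r.val := hq
        refine ⟨(⟨j, by rw [hq']; exact r.isLt⟩, s), ?_⟩
        simp only [ψ, Option.some.injEq, Prod.mk.injEq, and_true]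
        congr 1
        exact Fin.ext hq'
      refine ⟨_, hB.map ψ hψ (P (Sum.inr p)) ?_ ?_⟩
      · intro u v
        constructor
        · rintro ⟨q, q', h1, h2, h3, -, -⟩ huv
          simp only [ψ, Option.some.injEq] at h1 h2
          apply h3
          rw [← h1, ← h2, huv]
        · intro huv
          exact ⟨_, _, rfl, rfl, fun h => huv (Subtype.ext h), rfl, rfl⟩
      · rintro x y ⟨q, q', rfl, rfl, -, h1, h2⟩
        exact ⟨hr q h1, hr q' h2⟩
  choose B hB using hpieces
  refine ⟨_, Good_s16.sum B P hB ?_ ?_ ?_⟩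
  · rintro (i | p) x y h
    · exact ⟨h.2, h.1⟩
    · obtain ⟨q, q', h1, h2, h3, h4, h5⟩ := h
      exact ⟨q', q, h2, h1, h3.symm, h5, h4⟩
  · intro x y hxy
    cases x with
    | none =>
      cases y with
      | none => exact absurd rfl hxy
      | some q =>
        exact ⟨Sum.inl q.1.1, by intro r hr; simp at hr, by
          intro r hr; rw [Option.some.injEq] at hr; rw [hr]⟩
    | some q =>
      cases y with
      | none =>
        exact ⟨Sum.inl q.1.1, by
          intro r hr; rw [Option.some.injEq] at hr; rw [hr], by intro r hr; simp at hr⟩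
      | some q' =>
        by_cases hq : q.1.1 = q'.1.1
        · exact ⟨Sum.inl q.1.1, by
            intro r hr; rw [Option.some.injEq] at hr; rw [hr], by
            intro r hr; rw [Option.some.injEq] at hr; rw [hq, hr]⟩
        · obtain ⟨p, hp⟩ := (hg q.1.1 q'.1.1 hq).2
            (⟨q.1.2.val, q.1.2.isLt.trans_le (hsz _)⟩, ⟨q'.1.2.val, q'.1.2.isLt.trans_le (hsz _)⟩)
          simp only [Prod.mk.injEq] at hp
          exact ⟨Sum.inr p, q, q', rfl, rfl, hq, by simp only [onB, hp.1], by simp only [onB, hp.2]⟩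
  · rintro x y hxy (i | p) (j | p') h h'
    · cases x with
      | some q => rw [← h.1 q rfl, ← h'.1 q rfl]
      | none =>
        cases y with
        | some q => rw [← h.2 q rfl, ← h'.2 q rfl]
        | none => exact absurd rfl hxy
    · obtain ⟨q, q', rfl, rfl, h3, -, -⟩ := h'
      exact absurd ((h.1 q rfl).trans (h.2 q' rfl).symm) h3
    · obtain ⟨q, q', rfl, rfl, h3, -, -⟩ := h
      exact absurd ((h'.1 q rfl).trans (h'.2 q' rfl).symm) h3
    · obtain ⟨q, q', rfl, rfl, h3, h4, h5⟩ := h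
      obtain ⟨r, r', e1, e2, -, h4', h5'⟩ := h'
      rw [Option.some.injEq] at e1 e2
      subst e1 e2
      have : p = p' := by
        apply (hg _ _ h3).1
        simp only [Prod.mk.injEq]
        exact ⟨Fin.ext (h4.trans h4'.symm), Fin.ext (h5.trans h5'.symm)⟩
      rw [this]

/-- The eight columns of the transversal design of six orthogonal squares. -/
def tdCol {m : ℕ} (f : Fin 6 → Fin m → Fin m → Fin m) (i : Fin 8) (p : Fin m × Fin m) : Fin m :=
  if h : i.val < 6 then f ⟨i.val, h⟩ p.1 p.2 else if i.val = 6 then p.1 else p.2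

theorem tdCol_injective {m : ℕ} {f : Fin 6 → Fin m → Fin m → Fin m} (hf : AreMOLS f)
    (i j : Fin 8) (hij : i ≠ j) :
    Function.Injective (fun p => (tdCol f i p, tdCol f j p)) := by
  have hv : i.val ≠ j.val := fun h => hij (Fin.ext h)
  rintro ⟨r, c⟩ ⟨r', c'⟩ h
  simp only [tdCol, Prod.mk.injEq] at h
  obtain ⟨h1, h2⟩ := h
  by_cases hi : i.val < 6 <;> by_cases hj : j.val < 6
  · rw [dif_pos hi, dif_pos hi] at h1
    rw [dif_pos hj, dif_pos hj] at h2
    exact hf.2 ⟨i, hi⟩ ⟨j, hj⟩ (fun e => hv (by simpa using e)) (Prod.ext h1 h2)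
  · rw [dif_pos hi, dif_pos hi] at h1
    rw [dif_neg hj, dif_neg hj] at h2
    split_ifs at h2 with h6
    · subst h2
      rw [((hf.1 ⟨i, hi⟩).1 r).1 h1]
    · subst h2
      rw [((hf.1 ⟨i, hi⟩).2 c).1 h1]
  · rw [dif_neg hi, dif_neg hi] at h1
    rw [dif_pos hj, dif_pos hj] at h2
    split_ifs at h1 with h6
    · subst h1
      rw [((hf.1 ⟨j, hj⟩).1 r).1 h2]
    · subst h1
      rw [((hf.1 ⟨j, hj⟩).2 c).1 h2]
  · rw [dif_neg hi, dif_neg hi] at h1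
    rw [dif_neg hj, dif_neg hj] at h2
    split_ifs at h1 h2 with h6 h7 h7
    · omega
    · rw [h1, h2]
    · rw [h1, h2]
    · omega

/-- If `N(m) ≥ 6` and `0 ≤ a, b ≤ m`, and for each
`v ∈ {3m+1, 3a+1, 3b+1}` there is a super-simple `2-(v,4,2)` directed design
in which every defining set contains at least half of the blocks, then there
is such a design on `18m + 3a + 3b + 1` points. -/
theorem superSimple_DD_half_of_six_MOLS (m a b : ℕ) (hm : 0 < m)
    (hMOLS : ∃ f : Fin 6 → Fin m → Fin m → Fin m, AreMOLS f)
    (ha : a ≤ m) (hb : b ≤ m)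
    (hinput : ∀ v ∈ ({3 * m + 1, 3 * a + 1, 3 * b + 1} : Finset ℕ),
      ∃ D : DirectedDesign (Fin v) 2 4 2, D.SuperSimple ∧ D.DefiningHalf) :
    ∃ D : DirectedDesign (Fin (18 * m + 3 * a + 3 * b + 1)) 2 4 2,
      D.SuperSimple ∧ D.DefiningHalf := by
  obtain ⟨f, hf⟩ := hMOLS
  let sz : Fin 8 → ℕ := ![m, m, m, m, m, m, a, b]
  have hszmem : ∀ i, sz i = m ∨ sz i = a ∨ sz i = b := by
    intro i; fin_cases i <;> simp [sz]
  have hsz : ∀ i, sz i ≤ m := by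
    intro i
    rcases hszmem i with h | h | h <;> omega
  have hsz6 : ∀ i : Fin 8, i.val < 6 → sz i = m := by
    intro i; fin_cases i <;> simp [sz]
  obtain ⟨B, hB⟩ := assemble m sz hsz hsz6 (tdCol f)
    (fun i j hij => Finite.injective_iff_bijective.1 (tdCol_injective hf i j hij)) (by
      intro i
      apply hinput
      rcases hszmem i with h | h | h <;> simp [h])
  have hcard : Fintype.card (Option ((Σ i, Fin (sz i)) × Fin 3)) =
      18 * m + 3 * a + 3 * b + 1 := by
    simp [sz, Fin.sum_univ_succ]
    ring
  let e := Fintype.equivFinOfCardEq hcard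
  exact (hB.map e e.injective (fun _ _ => True) (fun _ _ => Iff.rfl)
    (fun x y _ => ⟨e.surjective x, e.surjective y⟩)).to_design (fun _ _ _ => trivial)
end

section
/- Let m be a positive integer such that there exist 7 mutually orthogonal Latin squares of order m (i.e., N(m) ≥ 7), and let a, b, c be integers with 0 ≤ a, b, c ≤ m. If for each v ∈ {3m + 1, 3a + 1, 3b + 1, 3c + 1} there exists a super-simple 2-(v,4,2) directed design whose every defining set contains at least half of the blocks, then there exists a super-simple 2-(18m + 3a + 3b + 3c + 1, 4, 2) directed design whose every defining set contains at least half of the blocks. -/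
/-! ### General theory of pieces -/

set_option linter.unusedSectionVars false
set_option linter.unusedSimpArgs false

/-- All blocks are ordered quadruples of distinct points. -/
def WFBlocks {X : Type*} (B : Multiset (List X)) : Prop := ∀ b ∈ B, b.length = 4 ∧ b.Nodup

/-- Number of blocks in which `x` precedes `y`. -/
def pcnt {X : Type*} [DecidableEq X] (B : Multiset (List X)) (x y : X) : ℕ :=
  B.countP (fun b => [x, y].Sublist b)

/-- Every subcollection with less than half of the blocks has another completion covering the
same ordered pairs. -/
def HalfProp {X : Type*} [DecidableEq X] (B : Multiset (List X)) : Prop :=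
  ∀ S ≤ B, 2 * Multiset.card S < Multiset.card B →
    ∃ B', S ≤ B' ∧ B' ≠ B ∧ WFBlocks B' ∧ ∀ x y, x ≠ y → pcnt B' x y = pcnt B x y

/-- A super-simple collection of quadruples which covers the pairs in `R` twice, the other pairs
never, and has the half property. -/
structure Piece {X : Type*} [DecidableEq X] (R : X → X → Prop) (B : Multiset (List X)) :
    Prop where
  wf : WFBlocks B
  cov1 : ∀ x y, x ≠ y → R x y → pcnt B x y = 2
  cov0 : ∀ x y, x ≠ y → ¬ R x y → pcnt B x y = 0
  nd : B.Nodup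
  ss : ∀ b₁ ∈ B, ∀ b₂ ∈ B, b₁ ≠ b₂ → (b₁.toFinset ∩ b₂.toFinset).card ≤ 2
  half : HalfProp B

section
variable {X : Type*} [DecidableEq X]

theorem pcnt_pos {B : Multiset (List X)} {x y : X} :
    0 < pcnt B x y ↔ ∃ b ∈ B, [x, y].Sublist b := by
  unfold pcnt; rw [Multiset.countP_pos]

theorem pair_sub {p q : X} (h : p ≠ q) : ∀ {b : List X}, p ∈ b → q ∈ b →
    [p, q].Sublist b ∨ [q, p].Sublist b := by
  intro b
  induction b with
  | nil => intro hp; simp at hp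
  | cons z l ih =>
    intro hp hq
    rcases List.mem_cons.1 hp with rfl | hp'
    · rcases List.mem_cons.1 hq with rfl | hq
      · exact absurd rfl h
      · left; exact List.Sublist.cons_cons _ (List.singleton_sublist.2 hq)
    · rcases List.mem_cons.1 hq with rfl | hq
      · right; exact List.Sublist.cons_cons _ (List.singleton_sublist.2 hp')
      · rcases ih hp' hq with h | h
        · left; exact h.cons _
        · right; exact h.cons _

theorem ne_of_pair_sub {p q : X} {b : List X} (hb : b.Nodup) (h : [p, q].Sublist b) : p ≠ q := by
  have := hb.sublist h
  simpa using this

theorem half_zero : HalfProp (0 : Multiset (List X)) := by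
  intro S _ h; simp at h

theorem pcnt_add (A B : Multiset (List X)) (x y : X) :
    pcnt (A + B) x y = pcnt A x y + pcnt B x y := by
  unfold pcnt; exact Multiset.countP_add _ _ _

theorem wf_add {A B : Multiset (List X)} (hA : WFBlocks A) (hB : WFBlocks B) :
    WFBlocks (A + B) := by
  intro b hb
  rcases Multiset.mem_add.1 hb with h | h
  · exact hA b h
  · exact hB b h

theorem half_add {A B : Multiset (List X)} (hA : HalfProp A) (hB : HalfProp B)
    (wA : WFBlocks A) (wB : WFBlocks B) : HalfProp (A + B) := by
  intro S hS hc
  have hsplit : S - A + S ∩ A = S := Multiset.sub_add_inter S A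
  have h1 : S ∩ A ≤ A := Multiset.inter_le_right
  have h2 : S - A ≤ B := by
    rw [Multiset.sub_le_iff_le_add]; rw [add_comm]; exact hS
  have hcard : Multiset.card (S - A) + Multiset.card (S ∩ A) = Multiset.card S := by
    rw [← Multiset.card_add, hsplit]
  rw [Multiset.card_add] at hc
  by_cases h : 2 * Multiset.card (S ∩ A) < Multiset.card A
  · obtain ⟨A', hle, hne, hw, hp⟩ := hA _ h1 h
    refine ⟨A' + B, ?_, ?_, wf_add hw wB, ?_⟩
    · rw [← hsplit, add_comm]; exact add_le_add hle h2
    · intro he; exact hne (add_right_cancel he)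
    · intro x y hxy; rw [pcnt_add, pcnt_add, hp x y hxy]
  · obtain ⟨B', hle, hne, hw, hp⟩ := hB _ h2 (by omega)
    refine ⟨A + B', ?_, ?_, wf_add wA hw, ?_⟩
    · rw [← hsplit, add_comm]; exact add_le_add h1 hle
    · intro he; exact hne (add_left_cancel he)
    · intro x y hxy; rw [pcnt_add, pcnt_add, hp x y hxy]

theorem pair_sub_four (u v p q r s : X) : [u, v].Sublist [p, q, r, s] ↔
    (u = p ∧ (v = q ∨ v = r ∨ v = s)) ∨ (u = q ∧ (v = r ∨ v = s)) ∨ (u = r ∧ v = s) := by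
  simp only [List.cons_sublist_cons', List.singleton_sublist, List.mem_cons, List.not_mem_nil,
    List.sublist_nil]
  simp
  tauto

theorem half_pair {x y a b c d : X} (h1 : [x, y, a, b].Nodup) (h2 : [y, x, c, d].Nodup)
    (hne : [x, y, a, b] ≠ [x, y, c, d]) :
    HalfProp ({[x, y, a, b], [y, x, c, d]} : Multiset (List X)) := by
  intro S hS hc
  have hS0 : S = 0 := by
    rw [← Multiset.card_eq_zero]
    simp at hc; omega
  subst hS0
  simp only [List.nodup_cons, List.mem_cons, List.not_mem_nil, or_false, not_or,
    not_false_eq_true, List.nodup_nil, and_true] at h1 h2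
  refine ⟨{[y, x, a, b], [x, y, c, d]}, Multiset.zero_le _, ?_, ?_, ?_⟩
  · intro he
    have hm : [x, y, a, b] ∈ ({[y, x, a, b], [x, y, c, d]} : Multiset (List X)) := by
      rw [he]; simp
    simp only [Multiset.insert_eq_cons, Multiset.mem_cons, Multiset.mem_singleton] at hm
    rcases hm with hm | hm
    · simp only [List.cons.injEq] at hm; exact h1.1.1 hm.1
    · exact hne hm
  · intro l hl
    simp only [Multiset.insert_eq_cons, Multiset.mem_cons, Multiset.mem_singleton] at hl
    rcases hl with rfl | rfl <;> simp <;> grind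
  · intro u v huv
    simp only [pcnt, Multiset.insert_eq_cons, Multiset.countP_cons, ← Multiset.cons_zero,
      Multiset.countP_zero, pair_sub_four]
    by_cases e1 : u = x ∧ v = y
    · obtain ⟨rfl, rfl⟩ := e1
      grind
    by_cases e2 : u = y ∧ v = x
    · obtain ⟨rfl, rfl⟩ := e2
      grind
    have k1 : ∀ a b : X, ((u = y ∧ (v = x ∨ v = a ∨ v = b)) ∨ (u = x ∧ (v = a ∨ v = b)) ∨
      (u = a ∧ v = b)) ↔ ((u = x ∧ (v = y ∨ v = a ∨ v = b)) ∨ (u = y ∧ (v = a ∨ v = b)) ∨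
      (u = a ∧ v = b)) := by
      intro a b; tauto
    simp only [k1]

theorem half_sum {ι : Type*} (s : Finset ι) (B : ι → Multiset (List X))
    (h : ∀ i, HalfProp (B i)) (w : ∀ i, WFBlocks (B i)) :
    HalfProp (∑ i ∈ s, B i) ∧ WFBlocks (∑ i ∈ s, B i) := by
  classical
  induction s using Finset.induction_on with
  | empty => exact ⟨by simpa using half_zero, by intro b hb; simp at hb⟩
  | insert i s hi ih =>
    rw [Finset.sum_insert hi]
    exact ⟨half_add (h i) ih.1 (w i) ih.2, wf_add (w i) ih.2⟩

theorem pcnt_sum {ι : Type*} (s : Finset ι) (B : ι → Multiset (List X)) (x y : X) :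
    pcnt (∑ i ∈ s, B i) x y = ∑ i ∈ s, pcnt (B i) x y := by
  classical
  induction s using Finset.induction_on with
  | empty => simp [pcnt]
  | insert i s hi ih => rw [Finset.sum_insert hi, Finset.sum_insert hi, pcnt_add, ih]

/-- Two points of a block of a piece are related. -/
theorem Piece.rel {R : X → X → Prop} {B : Multiset (List X)} (h : Piece R B) {b : List X}
    (hb : b ∈ B) {x y : X} (hs : [x, y].Sublist b) : R x y := by
  by_contra hR
  have h0 := h.cov0 x y (ne_of_pair_sub (h.wf b hb).2 hs) hR
  have : 0 < pcnt B x y := pcnt_pos.2 ⟨b, hb, hs⟩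
  omega

theorem Piece.glue {ι : Type*} [Fintype ι] {R : ι → X → X → Prop} {B : ι → Multiset (List X)}
    (h : ∀ i, Piece (R i) (B i)) (hsymm : ∀ i x y, R i x y → R i y x)
    (hex : ∀ x y, x ≠ y → ∃ i, R i x y)
    (huniq : ∀ x y, x ≠ y → ∀ i j, R i x y → R j x y → i = j) :
    Piece (fun _ _ => True) (∑ i, B i) := by
  classical
  have hsum := half_sum Finset.univ B (fun i => (h i).half) (fun i => (h i).wf)
  have hrel : ∀ i, ∀ b ∈ B i, ∀ p q, p ≠ q → p ∈ b → q ∈ b → R i p q := by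
    intro i b hb p q hpq hp hq
    rcases pair_sub hpq hp hq with hs | hs
    · exact (h i).rel hb hs
    · exact hsymm _ _ _ ((h i).rel hb hs)
  have hcross : ∀ i j, i ≠ j → ∀ b ∈ B i, ∀ b' ∈ B j,
      (b.toFinset ∩ b'.toFinset).card ≤ 1 := by
    intro i j hij b hb b' hb'
    rw [Finset.card_le_one]
    intro p hp q hq
    simp only [Finset.mem_inter, List.mem_toFinset] at hp hq
    by_contra hpq
    exact hij (huniq p q hpq i j (hrel i b hb p q hpq hp.1 hq.1)
      (hrel j b' hb' p q hpq hp.2 hq.2))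
  refine ⟨hsum.2, ?_, ?_, ?_, ?_, hsum.1⟩
  · intro x y hxy _
    rw [pcnt_sum]
    obtain ⟨i, hi⟩ := hex x y hxy
    rw [Finset.sum_eq_single i]
    · exact (h i).cov1 x y hxy hi
    · intro j _ hji
      exact (h j).cov0 x y hxy (fun hj => hji (huniq x y hxy j i hj hi))
    · intro hi'; exact absurd (Finset.mem_univ i) hi'
  · intro x y _ hn; exact absurd trivial hn
  · rw [Multiset.nodup_iff_count_le_one]
    intro b
    rw [Multiset.count_sum']
    by_cases hb : ∃ i, b ∈ B i
    · obtain ⟨i, hi⟩ := hb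
      rw [Finset.sum_eq_single i]
      · exact Multiset.nodup_iff_count_le_one.1 (h i).nd b
      · intro j _ hji
        rw [Multiset.count_eq_zero]
        intro hj
        have h1 := hcross j i hji b hj b hi
        rw [Finset.inter_self, List.toFinset_card_of_nodup ((h i).wf b hi).2,
          ((h i).wf b hi).1] at h1
        omega
      · intro hi'; exact absurd (Finset.mem_univ i) hi'
    · push Not at hb
      rw [Finset.sum_eq_zero]
      · omega
      · intro i _; exact Multiset.count_eq_zero.2 (hb i)
  · intro b₁ h₁ b₂ h₂ hne
    obtain ⟨i, _, hi⟩ := Multiset.mem_sum.1 h₁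
    obtain ⟨j, _, hj⟩ := Multiset.mem_sum.1 h₂
    by_cases hij : i = j
    · subst hij; exact (h i).ss b₁ hi b₂ hj hne
    · exact (hcross i j hij b₁ hi b₂ hj).trans (by omega)

theorem Piece.congr {R R' : X → X → Prop} {B : Multiset (List X)} (h : Piece R B)
    (hR : ∀ x y, x ≠ y → (R x y ↔ R' x y)) : Piece R' B :=
  ⟨h.wf, fun x y hxy hr => h.cov1 x y hxy ((hR x y hxy).2 hr),
    fun x y hxy hr => h.cov0 x y hxy (fun h' => hr ((hR x y hxy).1 h')), h.nd, h.ss, h.half⟩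

/-- All points of all blocks lie in `s`. -/
def SuppIn {Y : Type*} (s : Set Y) (B : Multiset (List Y)) : Prop := ∀ b ∈ B, ∀ p ∈ b, p ∈ s

theorem exists_other {b : List X} (hl : b.length = 4) (hn : b.Nodup) (p : X) :
    ∃ q ∈ b, p ≠ q := by
  by_contra hcon
  push Not at hcon
  have : b.toFinset ⊆ {p} := by
    intro q hq; rw [List.mem_toFinset] at hq; simp [hcon q hq]
  have h2 := Finset.card_le_card this
  rw [List.toFinset_card_of_nodup hn, hl, Finset.card_singleton] at h2
  omega

theorem supp_of_pcnt {s : Set X} {B : Multiset (List X)} (hw : WFBlocks B)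
    (h : ∀ x y, x ≠ y → 0 < pcnt B x y → x ∈ s ∧ y ∈ s) : SuppIn s B := by
  intro b hb p hp
  obtain ⟨q, hq, hpq⟩ := exists_other (hw b hb).1 (hw b hb).2 p
  rcases pair_sub hpq hp hq with hs | hs
  · exact (h p q hpq (pcnt_pos.2 ⟨b, hb, hs⟩)).1
  · exact (h q p hpq.symm (pcnt_pos.2 ⟨b, hb, hs⟩)).2

variable {Y : Type*} [DecidableEq Y]

theorem pcnt_map {φ : Y → X} {s : Set Y} (hφ : Set.InjOn φ s) {B : Multiset (List Y)}
    (hB : SuppIn s B) {u v : Y} (hu : u ∈ s) (hv : v ∈ s) :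
    pcnt (B.map (List.map φ)) (φ u) (φ v) = pcnt B u v := by
  unfold pcnt
  rw [Multiset.countP_map, ← Multiset.countP_eq_card_filter]
  refine Multiset.countP_congr rfl ?_
  intro b hb
  apply propext
  constructor
  · intro h
    obtain ⟨l, hl, he⟩ := List.sublist_map_iff.1 h
    match l, hl, he with
    | [u', v'], hl, he =>
      simp only [List.map_cons, List.map_nil, List.cons.injEq, and_true] at he
      have hu' : u' ∈ s := hB b hb u' (hl.subset (by simp))
      have hv' : v' ∈ s := hB b hb v' (hl.subset (by simp))
      rw [hφ hu hu' he.1, hφ hv hv' he.2]; exact hl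
    | [], hl, he => simp at he
    | [_], hl, he => simp at he
    | _ :: _ :: _ :: _, hl, he => simp at he
  · intro h
    exact h.map φ

theorem pcnt_map_pos {φ : Y → X} {B : Multiset (List Y)} {x y : X}
    (h : 0 < pcnt (B.map (List.map φ)) x y) :
    ∃ u v, φ u = x ∧ φ v = y ∧ ∃ b ∈ B, [u, v].Sublist b := by
  obtain ⟨b', hb', hs⟩ := pcnt_pos.1 h
  obtain ⟨b, hb, rfl⟩ := Multiset.mem_map.1 hb'
  obtain ⟨l, hl, he⟩ := List.sublist_map_iff.1 hs
  match l, hl, he with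
  | [u', v'], hl, he =>
    simp only [List.map_cons, List.map_nil, List.cons.injEq, and_true] at he
    exact ⟨u', v', he.1.symm, he.2.symm, b, hb, hl⟩
  | [], hl, he => simp at he
  | [_], hl, he => simp at he
  | _ :: _ :: _ :: _, hl, he => simp at he

theorem wf_map {φ : Y → X} {s : Set Y} (hφ : Set.InjOn φ s) {B : Multiset (List Y)}
    (hB : SuppIn s B) (hw : WFBlocks B) : WFBlocks (B.map (List.map φ)) := by
  intro b' hb'
  obtain ⟨b, hb, rfl⟩ := Multiset.mem_map.1 hb'
  refine ⟨by rw [List.length_map]; exact (hw b hb).1, ?_⟩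
  exact List.Nodup.map_on (fun x hx y hy h => hφ (hB b hb x hx) (hB b hb y hy) h) (hw b hb).2

theorem list_map_injOn {φ : Y → X} {s : Set Y} (hφ : Set.InjOn φ s) {b₁ b₂ : List Y}
    (h₁ : ∀ p ∈ b₁, p ∈ s) (h₂ : ∀ p ∈ b₂, p ∈ s) (h : b₁.map φ = b₂.map φ) : b₁ = b₂ := by
  induction b₁ generalizing b₂ with
  | nil => cases b₂ with
    | nil => rfl
    | cons z l => simp at h
  | cons z l ih => cases b₂ with
    | nil => simp at h
    | cons z' l' =>
      simp only [List.map_cons, List.cons.injEq] at h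
      rw [hφ (h₁ z (by simp)) (h₂ z' (by simp)) h.1,
        ih (fun p hp => h₁ p (by simp [hp])) (fun p hp => h₂ p (by simp [hp])) h.2]

theorem map_inj_of_supp {φ : Y → X} {s : Set Y} (hφ : Set.InjOn φ s) {A B : Multiset (List Y)}
    (hA : SuppIn s A) (hB : SuppIn s B) (h : A.map (List.map φ) = B.map (List.map φ)) : A = B := by
  by_cases hne : Nonempty Y
  · have key : ∀ C : Multiset (List Y), SuppIn s C →
        (C.map (List.map φ)).map (List.map (Function.invFunOn φ s)) = C := by
      intro C hC
      rw [Multiset.map_map]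
      conv_rhs => rw [← Multiset.map_id C]
      refine Multiset.map_congr rfl ?_
      intro b hb
      simp only [Function.comp, List.map_map, id]
      conv_rhs => rw [← List.map_id b]
      refine List.map_congr_left ?_
      intro p hp
      exact hφ.leftInvOn_invFunOn (hC b hb p hp)
    rw [← key A hA, ← key B hB, h]
  · have hs : ∀ C D : Multiset (List Y), Multiset.card C = Multiset.card D → C = D := by
      intro C D hCD
      have : ∀ C : Multiset (List Y), C = Multiset.replicate (Multiset.card C) [] := by
        intro C
        rw [Multiset.eq_replicate]
        refine ⟨rfl, ?_⟩
        intro b _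
        cases b with
        | nil => rfl
        | cons z l => exact absurd ⟨z⟩ hne
      rw [this C, this D, hCD]
    apply hs
    have := congrArg Multiset.card h
    simpa using this

theorem exists_le_of_le_map {α β : Type*} [DecidableEq β] {f : α → β} {B : Multiset α}
    {S : Multiset β} (h : S ≤ B.map f) : ∃ S₀ ≤ B, S₀.map f = S := by
  induction B using Multiset.induction_on generalizing S with
  | empty =>
    refine ⟨0, le_rfl, ?_⟩
    simp only [Multiset.map_zero, Multiset.le_zero] at h
    simp [h]
  | cons b B ih =>
    rw [Multiset.map_cons] at h
    by_cases hb : f b ∈ S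
    · obtain ⟨S', rfl⟩ := Multiset.exists_cons_of_mem hb
      obtain ⟨S₀, h₀, rfl⟩ := ih ((Multiset.cons_le_cons_iff _).1 h)
      exact ⟨b ::ₘ S₀, Multiset.cons_le_cons _ h₀, by simp⟩
    · obtain ⟨S₀, h₀, rfl⟩ := ih ((Multiset.le_cons_of_notMem hb).1 h)
      exact ⟨S₀, h₀.trans (Multiset.le_cons_self _ _), rfl⟩

/-- Transport of pieces along maps which are injective on the support. -/
theorem Piece.map {R : Y → Y → Prop} {B : Multiset (List Y)} (h : Piece R B) {φ : Y → X}
    {s : Set Y} (hφ : Set.InjOn φ s) (hR : ∀ u v, R u v → u ∈ s ∧ v ∈ s) :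
    Piece (fun x y => ∃ u v, φ u = x ∧ φ v = y ∧ R u v) (B.map (List.map φ)) := by
  have hpos : ∀ x y, x ≠ y → 0 < pcnt B x y → x ∈ s ∧ y ∈ s := by
    intro x y _ hp
    obtain ⟨b, hb, hs⟩ := pcnt_pos.1 hp
    exact hR x y (h.rel hb hs)
  have hB : SuppIn s B := supp_of_pcnt h.wf hpos
  refine ⟨wf_map hφ hB h.wf, ?_, ?_, ?_, ?_, ?_⟩
  · rintro x y hxy ⟨u, v, rfl, rfl, hr⟩
    rw [pcnt_map hφ hB (hR u v hr).1 (hR u v hr).2]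
    exact h.cov1 u v (fun e => hxy (by rw [e])) hr
  · intro x y hxy hn
    by_contra h0
    obtain ⟨u, v, hu, hv, b, hb, hs⟩ := pcnt_map_pos (Nat.pos_of_ne_zero h0)
    exact hn ⟨u, v, hu, hv, h.rel hb hs⟩
  · exact Multiset.Nodup.map_on
      (fun b₁ h₁ b₂ h₂ he => list_map_injOn hφ (hB b₁ h₁) (hB b₂ h₂) he) h.nd
  · intro b₁' h₁' b₂' h₂' hne
    obtain ⟨b₁, h₁, rfl⟩ := Multiset.mem_map.1 h₁'
    obtain ⟨b₂, h₂, rfl⟩ := Multiset.mem_map.1 h₂'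
    refine le_trans ?_ (h.ss b₁ h₁ b₂ h₂ (fun e => hne (by rw [e])))
    have : ((b₁.map φ).toFinset ∩ (b₂.map φ).toFinset) ⊆
        (b₁.toFinset ∩ b₂.toFinset).image φ := by
      intro z hz
      simp only [Finset.mem_inter, List.mem_toFinset, List.mem_map] at hz
      obtain ⟨⟨u, hu, hu'⟩, ⟨v, hv, hv'⟩⟩ := hz
      have : u = v := hφ (hB b₁ h₁ u hu) (hB b₂ h₂ v hv) (hu'.trans hv'.symm)
      subst this
      exact Finset.mem_image.2 ⟨u, by simp [hu, hv], hu'⟩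
    exact (Finset.card_le_card this).trans Finset.card_image_le
  · intro S hS hc
    obtain ⟨S₀, hS₀, rfl⟩ : ∃ S₀ ≤ B, S₀.map (List.map φ) = S := by
      exact exists_le_of_le_map hS
    rw [Multiset.card_map, Multiset.card_map] at hc
    obtain ⟨B', hle, hne, hw, hp⟩ := h.half S₀ hS₀ hc
    have hB' : SuppIn s B' := supp_of_pcnt hw (fun x y hxy h0 => hpos x y hxy (hp x y hxy ▸ h0))
    refine ⟨B'.map (List.map φ), Multiset.map_le_map hle,
      fun he => hne (map_inj_of_supp hφ hB' hB he), wf_map hφ hB' hw, ?_⟩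
    intro x y hxy
    by_cases hex : ∃ u ∈ s, ∃ v ∈ s, φ u = x ∧ φ v = y
    · obtain ⟨u, hu, v, hv, rfl, rfl⟩ := hex
      rw [pcnt_map hφ hB hu hv, pcnt_map hφ hB' hu hv]
      exact hp u v (fun e => hxy (by rw [e]))
    · have hz : ∀ C : Multiset (List Y), SuppIn s C → pcnt (C.map (List.map φ)) x y = 0 := by
        intro C hC
        by_contra h0
        obtain ⟨u, v, hu, hv, b, hb, hs⟩ := pcnt_map_pos (Nat.pos_of_ne_zero h0)
        exact hex ⟨u, hC b hb u (hs.subset (by simp)), v, hC b hb v (hs.subset (by simp)), hu, hv⟩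
      rw [hz B hB, hz B' hB']

end

/-! ### Explicit ingredients: data and kernel-friendly checks -/

/-- Translation by `(i, j)` of the point `3 * g + k`, where the groups `g < M` are rotated. -/
def ptTrans (M i j x : ℕ) : ℕ :=
  3 * (bif Nat.blt (x / 3) M then (x / 3 + i) % M else x / 3) + (x % 3 + j) % 3

/-- A six-tuple encodes the two blocks `(x, y, a, b)` and `(y, x, c, d)`. -/
structure Tup where
  x : ℕ
  y : ℕ
  a : ℕ
  b : ℕ
  c : ℕ
  d : ℕ

/-- Apply a function to all entries. -/
def Tup.map (f : ℕ → ℕ) (t : Tup) : Tup := ⟨f t.x, f t.y, f t.a, f t.b, f t.c, f t.d⟩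

/-- All translates of the base tuples. -/
def devAll (M : ℕ) (base : List Tup) : List Tup :=
  base.flatMap fun t => (List.range M).flatMap fun i =>
    (List.range 3).map fun j => t.map (ptTrans M i j)

/-- All entries below `N`. -/
def Tup.bdB (N : ℕ) (t : Tup) : Bool :=
  Nat.blt t.x N && Nat.blt t.y N && Nat.blt t.a N && Nat.blt t.b N && Nat.blt t.c N &&
    Nat.blt t.d N

/-- The two blocks encoded by a tuple. -/
def Tup.blocks (t : Tup) : List (List ℕ) := [[t.x, t.y, t.a, t.b], [t.y, t.x, t.c, t.d]]

/-- The codes of the ordered pairs covered by a block. -/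
def pairCodes : List ℕ → List ℕ
  | [p, q, r, s] =>
    [32 * p + q, 32 * p + r, 32 * p + s, 32 * q + r, 32 * q + s, 32 * r + s]
  | _ => []

/-- Weight used to hash triples. -/
def wt (x : ℕ) : ℕ := (x + 1) ^ 9 % 26340

/-- The hash values of the triples covered by a block. -/
def tripleHashes : List ℕ → List ℕ
  | [p, q, r, s] =>
    [wt p + wt q + wt r, wt p + wt q + wt s, wt p + wt r + wt s, wt q + wt r + wt s]
  | _ => []

/-- The codes of the ordered pairs covered by the two blocks of a tuple. -/
def Tup.codes (t : Tup) : List ℕ := t.blocks.flatMap pairCodes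

/-- The hash values of the triples covered by the two blocks of a tuple. -/
def Tup.hashes (t : Tup) : List ℕ := t.blocks.flatMap tripleHashes

/-- Bitset test that a list has no duplicates (and avoids the set bits of `acc`). -/
def nodupB (l : List ℕ) : ℕ → Bool :=
  List.rec (motive := fun _ => ℕ → Bool) (fun _ => true)
    (fun c _ ih acc => bif Nat.testBit acc c then false else ih (acc ||| 2 ^ c)) l

/-- Bitset test that every entry occurs at most twice, followed by a final test on the bitsets
of entries occurring at least once and at least twice. -/
def twiceB (P : ℕ → ℕ → Bool) (l : List ℕ) : ℕ → ℕ → Bool :=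
  List.rec (motive := fun _ => ℕ → ℕ → Bool) (fun u v => P u v)
    (fun c _ ih u v => bif Nat.testBit u c then
      (bif Nat.testBit v c then false else ih u (v ||| 2 ^ c)) else ih (u ||| 2 ^ c) v) l

/-- Final test: cross pairs are covered twice, others are not covered. -/
def finB (N u v : ℕ) : Bool :=
  (List.range N).all fun x => (List.range N).all fun y =>
    bif Nat.beq (x / 3) (y / 3) then !(Nat.testBit u (32 * x + y)) else Nat.testBit v (32 * x + y)

/-- The full check. -/
def goodB (N : ℕ) (T : List Tup) : Bool :=
  (T.all (Tup.bdB N)) && (twiceB (finB N) (T.flatMap Tup.codes) 0 0 &&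
    nodupB (T.flatMap Tup.hashes) 0)

/-- Tuples for type `3^6`. -/
def T6 : List Tup := devAll 5 [⟨16, 10, 5, 8, 4, 6⟩, ⟨0, 7, 3, 11, 12, 16⟩, ⟨6, 12, 17, 4, 1, 3⟩]

/-- Tuples for type `3^7`. -/
def T7 : List Tup := devAll 7 [⟨18, 13, 7, 4, 3, 2⟩, ⟨3, 19, 2, 6, 0, 12⟩, ⟨15, 9, 13, 5, 7, 18⟩]

/-- Tuples for type `3^8`. -/
def T8 : List Tup := devAll 7 [⟨13, 19, 8, 11, 16, 7⟩, ⟨3, 10, 15, 14, 21, 17⟩,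
  ⟨21, 6, 16, 12, 11, 19⟩, ⟨8, 0, 5, 19, 9, 22⟩]

/-- Tuples for type `3^9`. -/
def T9 : List Tup := devAll 9 [⟨11, 26, 2, 22, 18, 16⟩, ⟨9, 12, 23, 2, 4, 17⟩,
  ⟨22, 13, 19, 26, 2, 15⟩, ⟨25, 13, 7, 21, 23, 17⟩]

set_option maxRecDepth 100000 in
theorem good6 : goodB 18 T6 = true := by decide +kernel

set_option maxRecDepth 100000 in
theorem good7 : goodB 21 T7 = true := by decide +kernel

set_option maxRecDepth 100000 in
theorem good8 : goodB 24 T8 = true := by decide +kernel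

set_option maxRecDepth 100000 in
theorem good9 : goodB 27 T9 = true := by decide +kernel


/-! ### Soundness of the checks -/

theorem nodupB_sound : ∀ (l : List ℕ) (acc : ℕ), nodupB l acc = true →
    l.Nodup ∧ ∀ c ∈ l, acc.testBit c = false := by
  intro l
  induction l with
  | nil => intro acc _; simp
  | cons c l ih =>
    intro acc h
    change (bif Nat.testBit acc c then false else nodupB l (acc ||| 2 ^ c)) = true at h
    cases hc : Nat.testBit acc c with
    | true => simp [hc] at h
    | false =>
      rw [hc] at h
      obtain ⟨h1, h2⟩ := ih _ h
      have h3 : ∀ e ∈ l, acc.testBit e = false ∧ c ≠ e := by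
        intro e he
        have := h2 e he
        rw [Nat.testBit_or, Nat.testBit_two_pow] at this
        simpa using this
      refine ⟨List.nodup_cons.2 ⟨fun hm => (h3 c hm).2 rfl, h1⟩, ?_⟩
      intro e he
      rcases List.mem_cons.1 he with rfl | he
      · exact hc
      · exact (h3 e he).1

theorem twiceB_sound (P : ℕ → ℕ → Bool) : ∀ (l : List ℕ) (u v : ℕ) (k : ℕ → ℕ),
    (∀ c, k c ≤ 2) → (∀ c, u.testBit c = true ↔ 1 ≤ k c) → (∀ c, v.testBit c = true ↔ 2 ≤ k c) →
    twiceB P l u v = true → ∃ u' v', P u' v' = true ∧ ∀ c, k c + l.count c ≤ 2 ∧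
      (u'.testBit c = true ↔ 1 ≤ k c + l.count c) ∧
      (v'.testBit c = true ↔ 2 ≤ k c + l.count c) := by
  intro l
  induction l with
  | nil =>
    intro u v k h0 h1 h2 h
    exact ⟨u, v, h, fun c => ⟨by simpa using h0 c, by simpa using h1 c, by simpa using h2 c⟩⟩
  | cons d l ih =>
    intro u v k h0 h1 h2 h
    change (bif Nat.testBit u d then (bif Nat.testBit v d then false else
      twiceB P l u (v ||| 2 ^ d)) else twiceB P l (u ||| 2 ^ d) v) = true at h
    have hcnt : ∀ c, (k c + if c = d then 1 else 0) + l.count c = k c + (d :: l).count c := by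
      intro c
      rw [List.count_cons]
      by_cases hcd : c = d
      · subst hcd; simp; omega
      · have : d ≠ c := fun e => hcd e.symm
        simp [hcd, this]
    have hu := h1 d
    have hv := h2 d
    have hk := h0 d
    cases hud : Nat.testBit u d with
    | true =>
      cases hvd : Nat.testBit v d with
      | true => simp [hud, hvd] at h
      | false =>
        rw [hud, hvd] at h
        simp only [hud, hvd, true_iff] at hu hv
        obtain ⟨u', v', hP, hc⟩ := ih u (v ||| 2 ^ d) (fun c => k c + if c = d then 1 else 0)
          (by
            intro c
            have := h0 c
            by_cases hcd : c = d
            · subst hcd; simp at hv ⊢; omega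
            · simpa [hcd] using this)
          (by
            intro c
            rw [h1 c]
            by_cases hcd : c = d
            · subst hcd; simp; omega
            · simp [hcd])
          (by
            intro c
            rw [Nat.testBit_or, Nat.testBit_two_pow]
            by_cases hcd : c = d
            · subst hcd; simp; omega
            · have : d ≠ c := fun e => hcd e.symm
              simp [hcd, this, h2 c]) h
        exact ⟨u', v', hP, fun c => by have := hc c; simpa only [hcnt] using this⟩
    | false =>
      rw [hud] at h
      simp only [hud, Bool.false_eq_true, false_iff] at hu
      obtain ⟨u', v', hP, hc⟩ := ih (u ||| 2 ^ d) v (fun c => k c + if c = d then 1 else 0)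
        (by
          intro c
          have := h0 c
          by_cases hcd : c = d
          · subst hcd; simp; omega
          · simpa [hcd] using this)
        (by
          intro c
          rw [Nat.testBit_or, Nat.testBit_two_pow]
          by_cases hcd : c = d
          · subst hcd; simp
          · have : d ≠ c := fun e => hcd e.symm
            simp [hcd, this, h1 c])
        (by
          intro c
          rw [h2 c]
          by_cases hcd : c = d
          · subst hcd; simp; omega
          · simp [hcd]) h
      exact ⟨u', v', hP, fun c => by have := hc c; simpa only [hcnt] using this⟩

/-- The block collection of a list of tuples. -/
def tupBlocks (T : List Tup) : List (List ℕ) := T.flatMap Tup.blocks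

theorem twice_counts {N : ℕ} {C : List ℕ} (h : twiceB (finB N) C 0 0 = true) :
    ∀ x < N, ∀ y < N, C.count (32 * x + y) = if x / 3 = y / 3 then 0 else 2 := by
  obtain ⟨u, v, hP, hc⟩ := twiceB_sound (finB N) C 0 0 (fun _ => 0) (by simp) (by simp)
    (by simp) h
  intro x hx y hy
  obtain ⟨c1, c2, c3⟩ := hc (32 * x + y)
  simp only [finB, List.all_eq_true, List.mem_range] at hP
  have := hP x hx y hy
  by_cases hxy : x / 3 = y / 3
  · have hb : Nat.beq (x / 3) (y / 3) = true := by rw [Nat.beq_eq]; exact hxy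
    rw [hb] at this
    rw [if_pos hxy]
    have hf : Nat.testBit u (32 * x + y) = false := by simpa using this
    rw [hf] at c2
    simp only [Bool.false_eq_true, false_iff] at c2
    omega
  · have hb : Nat.beq (x / 3) (y / 3) = false := by
      rw [Bool.eq_false_iff]; intro hb; rw [Nat.beq_eq] at hb; exact hxy hb
    rw [hb] at this
    rw [if_neg hxy]
    have hf : Nat.testBit v (32 * x + y) = true := by simpa using this
    have := c3.1 hf
    omega

theorem count_pairCodes {p q r s x y : ℕ} (hn : [p, q, r, s].Nodup) (hp : p < 32) (hq : q < 32)
    (hr : r < 32) (hs : s < 32) (hx : x < 32) (hy : y < 32) :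
    (pairCodes [p, q, r, s]).count (32 * x + y) =
      if [x, y].Sublist [p, q, r, s] then 1 else 0 := by
  have e : ∀ a b : ℕ, a < 32 → b < 32 → (32 * a + b = 32 * x + y ↔ x = a ∧ y = b) := by
    intro a b ha hb; omega
  simp only [List.nodup_cons, List.mem_cons, List.not_mem_nil, or_false, not_or,
    not_false_eq_true, List.nodup_nil, and_true] at hn
  simp only [pairCodes, List.count_cons, List.count_nil, beq_iff_eq, pair_sub_four,
    e p q hp hq, e p r hp hr, e p s hp hs, e q r hq hr, e q s hq hs, e r s hr hs]
  grind

theorem hash_mem {p q r s : ℕ} (hn : [p, q, r, s].Nodup) {t : Finset ℕ}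
    (ht : t ⊆ [p, q, r, s].toFinset) (hc : t.card = 3) :
    ∑ z ∈ t, wt z ∈ tripleHashes [p, q, r, s] := by
  have h4 : [p, q, r, s].toFinset.card = 4 := by
    rw [List.toFinset_card_of_nodup hn]; rfl
  have h1 : ([p, q, r, s].toFinset \ t).card = 1 := by
    rw [Finset.card_sdiff_of_subset ht, h4, hc]
  obtain ⟨z, hz⟩ := Finset.card_eq_one.1 h1
  have hsum : ∑ w ∈ [p, q, r, s].toFinset \ t, wt w + ∑ w ∈ t, wt w =
      ∑ w ∈ [p, q, r, s].toFinset, wt w := Finset.sum_sdiff ht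
  rw [hz, Finset.sum_singleton, List.sum_toFinset _ hn] at hsum
  simp only [List.map_cons, List.map_nil, List.sum_cons, List.sum_nil] at hsum
  have hzm : z ∈ [p, q, r, s].toFinset := by
    have : z ∈ [p, q, r, s].toFinset \ t := by rw [hz]; simp
    exact (Finset.mem_sdiff.1 this).1
  simp only [List.mem_toFinset, List.mem_cons, List.not_mem_nil, or_false] at hzm
  simp only [tripleHashes, List.mem_cons, List.not_mem_nil, or_false]
  rcases hzm with rfl | rfl | rfl | rfl <;> omega

theorem exists_four {b : List ℕ} (h : b.length = 4) : ∃ p q r s, b = [p, q, r, s] := by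
  match b, h with
  | [p, q, r, s], _ => exact ⟨p, q, r, s, rfl⟩

theorem nodup_eight {a₁ a₂ a₃ a₄ a₅ a₆ a₇ a₈ : ℕ}
    (h : [a₁, a₂, a₃, a₄, a₅, a₆, a₇, a₈].Nodup) : a₁ ≠ a₅ := by
  rintro rfl
  simp at h

theorem hashes_eq (t : Tup) : t.hashes = [wt t.x + wt t.y + wt t.a, wt t.x + wt t.y + wt t.b,
    wt t.x + wt t.a + wt t.b, wt t.y + wt t.a + wt t.b, wt t.y + wt t.x + wt t.c,
    wt t.y + wt t.x + wt t.d, wt t.y + wt t.c + wt t.d, wt t.x + wt t.c + wt t.d] := rfl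

theorem piece_nat {N : ℕ} (hN : N ≤ 32) {T : List Tup} (h : goodB N T = true) :
    Piece (fun x y => x < N ∧ y < N ∧ x / 3 ≠ y / 3) (↑(tupBlocks T) : Multiset (List ℕ)) := by
  simp only [goodB, Bool.and_eq_true, List.all_eq_true] at h
  obtain ⟨hbd, htw, hnd⟩ := h
  have hcodes : T.flatMap Tup.codes = (tupBlocks T).flatMap pairCodes := by
    unfold tupBlocks; rw [List.flatMap_assoc]; rfl
  have hhash : T.flatMap Tup.hashes = (tupBlocks T).flatMap tripleHashes := by
    unfold tupBlocks; rw [List.flatMap_assoc]; rfl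
  have hcount := twice_counts htw
  rw [hcodes] at hcount
  have hnd1 := (nodupB_sound _ _ hnd).1
  have hndT := (List.nodup_flatMap.1 hnd1).1
  rw [hhash] at hnd1
  have hdis := (List.nodup_flatMap.1 hnd1).2
  -- shape of blocks
  have hlen : ∀ b ∈ tupBlocks T, b.length = 4 ∧ ∀ p ∈ b, p < N := by
    intro b hb
    obtain ⟨t, ht, hbt⟩ := List.mem_flatMap.1 hb
    have := hbd t ht
    simp only [Tup.bdB, Bool.and_eq_true, Nat.blt_eq] at this
    simp only [Tup.blocks, List.mem_cons, List.not_mem_nil, or_false] at hbt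
    rcases hbt with rfl | rfl
    · refine ⟨rfl, ?_⟩
      simp; tauto
    · refine ⟨rfl, ?_⟩
      simp; tauto
  have hgr : ∀ p q r s, [p, q, r, s] ∈ tupBlocks T → ∀ x y,
      32 * x + y ∈ pairCodes [p, q, r, s] → x < N → y < N → x / 3 ≠ y / 3 := by
    intro p q r s hb x y hm hx hy he
    have h0 := hcount x hx y hy
    rw [if_pos he, List.count_eq_zero] at h0
    exact h0 (List.mem_flatMap.2 ⟨_, hb, hm⟩)
  have hwf : ∀ b ∈ tupBlocks T, b.length = 4 ∧ b.Nodup := by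
    intro b hb
    refine ⟨(hlen b hb).1, ?_⟩
    obtain ⟨p, q, r, s, rfl⟩ := exists_four (hlen b hb).1
    have hl := (hlen _ hb).2
    simp only [List.mem_cons, List.not_mem_nil, or_false, forall_eq_or_imp, forall_eq] at hl
    obtain ⟨hp, hq, hr, hs⟩ := hl
    have hg := hgr p q r s hb
    have a1 := hg p q (by simp [pairCodes]) hp hq
    have a2 := hg p r (by simp [pairCodes]) hp hr
    have a3 := hg p s (by simp [pairCodes]) hp hs
    have a4 := hg q r (by simp [pairCodes]) hq hr
    have a5 := hg q s (by simp [pairCodes]) hq hs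
    have a6 := hg r s (by simp [pairCodes]) hr hs
    simp only [List.nodup_cons, List.mem_cons, List.not_mem_nil, or_false, not_or,
      not_false_eq_true, List.nodup_nil, and_true]
    refine ⟨⟨?_, ?_, ?_⟩, ⟨?_, ?_⟩, ?_⟩ <;> (rintro rfl; simp_all)
  have hpc : ∀ x < 32, ∀ y < 32, ∀ L : List (List ℕ), (∀ b ∈ L, b ∈ tupBlocks T) →
      L.countP (fun b => [x, y].Sublist b) = (L.flatMap pairCodes).count (32 * x + y) := by
    intro x hx y hy L
    induction L with
    | nil => intro _; simp
    | cons b L ih =>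
      intro hL
      have hb := hL b (by simp)
      rw [List.countP_cons, List.flatMap_cons, List.count_append,
        ih (fun b hb => hL b (by simp [hb])), add_comm]
      congr 1
      obtain ⟨hl, hn⟩ := hwf b hb
      have hlt := (hlen b hb).2
      obtain ⟨p, q, r, s, rfl⟩ := exists_four hl
      simp only [List.mem_cons, List.not_mem_nil, or_false, forall_eq_or_imp, forall_eq] at hlt
      rw [count_pairCodes hn (by omega) (by omega) (by omega) (by omega) hx hy]
      simp
  have hpc' : ∀ x y, pcnt (↑(tupBlocks T) : Multiset (List ℕ)) x y =
      (tupBlocks T).countP (fun b => [x, y].Sublist b) := by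
    intro x y; unfold pcnt; rw [Multiset.coe_countP]
  have hpw : (tupBlocks T).Pairwise
      (fun b₁ b₂ => (b₁.toFinset ∩ b₂.toFinset).card ≤ 2) := by
    refine hdis.imp_of_mem ?_
    intro b₁ b₂ h₁ h₂ hd
    by_contra hcon
    obtain ⟨t, ht, htc⟩ := Finset.exists_subset_card_eq
      (show 3 ≤ (b₁.toFinset ∩ b₂.toFinset).card by omega)
    obtain ⟨l1, n1⟩ := hwf b₁ h₁
    obtain ⟨l2, n2⟩ := hwf b₂ h₂
    obtain ⟨p, q, r, s, rfl⟩ := exists_four l1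
    obtain ⟨p', q', r', s', rfl⟩ := exists_four l2
    exact hd (hash_mem n1 (ht.trans Finset.inter_subset_left) htc)
      (hash_mem n2 (ht.trans Finset.inter_subset_right) htc)
  refine ⟨?_, ?_, ?_, ?_, ?_, ?_⟩
  · intro b hb; exact hwf b (Multiset.mem_coe.1 hb)
  · rintro x y _ ⟨hx, hy, hxy⟩
    rw [hpc', hpc x (by omega) y (by omega) _ (fun b hb => hb), hcount x hx y hy, if_neg hxy]
  · intro x y hne hn
    by_contra h0
    obtain ⟨b, hb, hs⟩ := pcnt_pos.1 (Nat.pos_of_ne_zero h0)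
    have hx := (hlen b hb).2 x (hs.subset (by simp))
    have hy := (hlen b hb).2 y (hs.subset (by simp))
    rw [hpc', hpc x (by omega) y (by omega) _ (fun b hb => hb), hcount x hx y hy] at h0
    by_cases hxy : x / 3 = y / 3
    · simp [hxy] at h0
    · exact hn ⟨hx, hy, hxy⟩
  · rw [Multiset.coe_nodup]
    refine hpw.imp_of_mem ?_
    rintro b₁ b₂ h₁ _ hc rfl
    rw [Finset.inter_self, List.toFinset_card_of_nodup (hwf _ h₁).2, (hwf _ h₁).1] at hc
    omega
  · intro b₁ h₁ b₂ h₂ hne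
    have hsym : Std.Symm (fun b₁ b₂ : List ℕ => (b₁.toFinset ∩ b₂.toFinset).card ≤ 2) :=
      ⟨fun a b hab => by rw [Finset.inter_comm]; exact hab⟩
    exact hpw.forall h₁ h₂ hne
  · have key : ∀ T' : List Tup, (∀ t ∈ T', t ∈ T) →
        HalfProp (↑(tupBlocks T') : Multiset (List ℕ)) ∧
        WFBlocks (↑(tupBlocks T') : Multiset (List ℕ)) := by
      intro T'
      induction T' with
      | nil => intro _; exact ⟨half_zero, by intro b hb; simp [tupBlocks] at hb⟩
      | cons t T' ih =>
        intro hT'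
        obtain ⟨ih1, ih2⟩ := ih (fun t ht => hT' t (by simp [ht]))
        have ht := hT' t (by simp)
        have e : (↑(tupBlocks (t :: T')) : Multiset (List ℕ)) =
            {[t.x, t.y, t.a, t.b], [t.y, t.x, t.c, t.d]} + ↑(tupBlocks T') := by
          unfold tupBlocks; rw [List.flatMap_cons, ← Multiset.coe_add]; rfl
        have n1 := hwf [t.x, t.y, t.a, t.b]
          (List.mem_flatMap.2 ⟨t, ht, by simp [Tup.blocks]⟩)
        have n2 := hwf [t.y, t.x, t.c, t.d]
          (List.mem_flatMap.2 ⟨t, ht, by simp [Tup.blocks]⟩)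
        have w : WFBlocks ({[t.x, t.y, t.a, t.b], [t.y, t.x, t.c, t.d]} :
            Multiset (List ℕ)) := by
          intro b hb
          simp only [Multiset.insert_eq_cons, Multiset.mem_cons, Multiset.mem_singleton] at hb
          rcases hb with rfl | rfl
          · exact n1
          · exact n2
        rw [e]
        refine ⟨half_add (half_pair n1.2 n2.2 ?_) ih1 w ih2, wf_add w ih2⟩
        intro he
        simp only [List.cons.injEq, true_and, and_true] at he
        have hh := hndT t ht
        rw [hashes_eq] at hh
        exact nodup_eight hh (by rw [he.1, add_comm (wt t.x)])
    exact (key T (fun t ht => ht)).1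

/-- Ingredient designs of type `3^n` for `n = 6, 7, 8, 9`. -/
theorem exists_ingredient (U : Type*) [DecidableEq U] [Fintype U] (h6 : 6 ≤ Fintype.card U)
    (h9 : Fintype.card U ≤ 9) :
    ∃ B : Multiset (List (U × Fin 3)), Piece (fun p q => p.1 ≠ q.1) B := by
  obtain ⟨n, hn⟩ : ∃ n, n = Fintype.card U := ⟨_, rfl⟩
  rw [← hn] at h6 h9
  have hT : ∃ T : List Tup, goodB (3 * n) T = true := by
    interval_cases n
    · exact ⟨T6, good6⟩
    · exact ⟨T7, good7⟩
    · exact ⟨T8, good8⟩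
    · exact ⟨T9, good9⟩
  obtain ⟨T, hT⟩ := hT
  have hP := piece_nat (by omega) hT
  have : NeZero n := ⟨by omega⟩
  let e : Fin n ≃ U := (Fintype.equivFinOfCardEq hn.symm).symm
  let φ : ℕ → U × Fin 3 := fun p => (e (Fin.ofNat n (p / 3)), Fin.ofNat 3 p)
  have hval : ∀ p < 3 * n, (Fin.ofNat n (p / 3)).val = p / 3 := by
    intro p hp; simp only [Fin.ofNat]; exact Nat.mod_eq_of_lt (by omega)
  have hfst : ∀ p < 3 * n, ∀ q < 3 * n, (φ p).1 = (φ q).1 → p / 3 = q / 3 := by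
    intro p hp q hq hpq
    have := congrArg Fin.val (e.injective hpq)
    rwa [hval p hp, hval q hq] at this
  have hinj : Set.InjOn φ {p | p < 3 * n} := by
    intro p hp q hq hpq
    have h1 := hfst p hp q hq (congrArg Prod.fst hpq)
    have h2 := congrArg (fun z : U × Fin 3 => z.2.val) hpq
    simp only [φ, Fin.ofNat] at h2
    omega
  refine ⟨_, (hP.map hinj (fun u v huv => ⟨huv.1, huv.2.1⟩)).congr ?_⟩
  intro x y hxy
  constructor
  · rintro ⟨u, v, rfl, rfl, hu, hv, huv⟩ he
    exact huv (hfst u hu v hv he)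
  · intro hne
    have hsurj : ∀ z : U × Fin 3, ∃ p, p < 3 * n ∧ φ p = z := by
      rintro ⟨g, k⟩
      have hg := (e.symm g).isLt
      have hk := k.isLt
      refine ⟨3 * (e.symm g).val + k.val, by omega, ?_⟩
      have h1 : Fin.ofNat n ((3 * (e.symm g).val + k.val) / 3) = e.symm g := by
        apply Fin.ext
        rw [hval _ (by omega)]; omega
      have h2 : Fin.ofNat 3 (3 * (e.symm g).val + k.val) = k := by
        apply Fin.ext
        simp only [Fin.ofNat]; omega
      simp only [φ, h1, h2, Equiv.apply_symm_apply]
    obtain ⟨u, hu, rfl⟩ := hsurj x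
    obtain ⟨v, hv, rfl⟩ := hsurj y
    refine ⟨u, v, rfl, rfl, hu, hv, ?_⟩
    intro he
    apply hne
    simp only [φ, he]

/-! ### Main construction -/

theorem piece_of_design {v : ℕ} (D : DirectedDesign (Fin v) 2 4 2) (hs : D.SuperSimple)
    (hd : D.DefiningHalf) : Piece (fun _ _ => True) D.blocks := by
  refine ⟨fun b hb => ⟨D.len b hb, D.nodup b hb⟩, ?_, ?_, hs.1, hs.2, ?_⟩
  · intro x y hxy _
    exact D.covers [x, y] rfl (by simpa using hxy)
  · intro x y _ hn; exact absurd trivial hn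
  · intro S hS hc
    have hnot : ¬ D.IsDefiningSet S := by
      intro h; have := hd S h; omega
    unfold DirectedDesign.IsDefiningSet at hnot
    push Not at hnot
    obtain ⟨D', hle, hne⟩ := hnot hS
    refine ⟨D'.blocks, hle, hne, fun b hb => ⟨D'.len b hb, D'.nodup b hb⟩, ?_⟩
    intro x y hxy
    exact (D'.covers [x, y] rfl (by simpa using hxy)).trans
      (D.covers [x, y] rfl (by simpa using hxy)).symm

theorem covers_of_pcnt {X : Type*} [DecidableEq X] {B : Multiset (List X)}
    (h : ∀ x y, x ≠ y → pcnt B x y = 2) (s : List X) (hl : s.length = 2) (hn : s.Nodup) :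
    B.countP (fun b => s.Sublist b) = 2 := by
  match s, hl, hn with
  | [x, y], _, hn => exact h x y (by simpa using hn)

theorem design_of_piece {X : Type*} [DecidableEq X] {B : Multiset (List X)}
    (h : Piece (fun _ _ => True) B) :
    ∃ D : DirectedDesign X 2 4 2, D.SuperSimple ∧ D.DefiningHalf := by
  have hc : ∀ x y, x ≠ y → pcnt B x y = 2 := fun x y hxy => h.cov1 x y hxy trivial
  refine ⟨⟨B, fun b hb => (h.wf b hb).1, fun b hb => (h.wf b hb).2, covers_of_pcnt hc⟩,
    ⟨h.nd, h.ss⟩, ?_⟩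
  rintro S ⟨hle, hu⟩
  by_contra hcon
  obtain ⟨B', hle₂, hne, hw, hp⟩ := h.half S hle (not_le.1 hcon)
  exact hne (hu ⟨B', fun b hb => (hw b hb).1, fun b hb => (hw b hb).2,
    covers_of_pcnt (fun x y hxy => (hp x y hxy).trans (hc x y hxy))⟩ hle₂)

/-- The coordinate functions of the transversal design given by MOLS. -/
def tdCoord {m : ℕ} (f : Fin 7 → Fin m → Fin m → Fin m) (g : Fin 9) (β : Fin m × Fin m) :
    Fin m :=
  Fin.cases (motive := fun _ => Fin m) β.1
    (fun g' : Fin 8 => Fin.cases (motive := fun _ => Fin m) β.2 (fun s => f s β.1 β.2) g') g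

theorem tdCoord_injective {m : ℕ} {f : Fin 7 → Fin m → Fin m → Fin m} (hf : AreMOLS f)
    (g h : Fin 9) (hgh : g ≠ h) :
    Function.Injective (fun β => (tdCoord f g β, tdCoord f h β)) := by
  obtain ⟨hL, hO⟩ := hf
  have key : ∀ g h : Fin 9, g ≠ h → ∀ β γ, tdCoord f g β = tdCoord f g γ →
      tdCoord f h β = tdCoord f h γ → β = γ := by
    clear g h hgh
    have sym1 : ∀ s : Fin 7, ∀ β γ : Fin m × Fin m, β.1 = γ.1 → f s β.1 β.2 = f s γ.1 γ.2 →
        β = γ := by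
      rintro s ⟨i, j⟩ ⟨i', j'⟩ h1 h2
      simp only at h1 h2
      subst h1
      rw [((hL s).1 i).1 h2]
    have sym2 : ∀ s : Fin 7, ∀ β γ : Fin m × Fin m, β.2 = γ.2 → f s β.1 β.2 = f s γ.1 γ.2 →
        β = γ := by
      rintro s ⟨i, j⟩ ⟨i', j'⟩ h1 h2
      simp only at h1 h2
      subst h1
      have := ((hL s).2 j).1 h2
      rw [this]
    intro g h hgh β γ
    cases g using Fin.cases with
    | zero => cases h using Fin.cases with
      | zero => exact absurd rfl hgh
      | succ h => cases h using Fin.cases with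
        | zero => intro h1 h2; exact Prod.ext h1 h2
        | succ h => intro h1 h2; exact sym1 h β γ h1 h2
    | succ g => cases g using Fin.cases with
      | zero => cases h using Fin.cases with
        | zero => intro h1 h2; exact Prod.ext h2 h1
        | succ h => cases h using Fin.cases with
          | zero => exact absurd rfl hgh
          | succ h => intro h1 h2; exact sym2 h β γ h1 h2
      | succ g => cases h using Fin.cases with
        | zero => intro h1 h2; exact sym1 g β γ h2 h1
        | succ h => cases h using Fin.cases with
          | zero => intro h1 h2; exact sym2 g β γ h2 h1
          | succ h =>
            intro h1 h2
            exact hO g h (fun e => hgh (by rw [e])) (Prod.ext h1 h2)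
  intro β γ hβγ
  exact key g h hgh β γ (congrArg Prod.fst hβγ) (congrArg Prod.snd hβγ)

/-- The point set of the final design. -/
abbrev BigPt (sz : Fin 9 → ℕ) : Type := Option ((Σ g : Fin 9, Fin (sz g)) × Fin 3)

/-- Embedding of an extended group. -/
def grpMap (sz : Fin 9 → ℕ) (g : Fin 9) (o : Option (Fin (sz g) × Fin 3)) : BigPt sz :=
  o.map fun p => (⟨g, p.1⟩, p.2)

theorem grpMap_injective (sz : Fin 9 → ℕ) (g : Fin 9) : Function.Injective (grpMap sz g) := by
  apply Option.map_injective
  rintro ⟨u, k⟩ ⟨u', k'⟩ h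
  simpa using h

/-- The groups meeting a truncated block. -/
abbrev LiveGrp {m : ℕ} (sz : Fin 9 → ℕ) (F : Fin 9 → Fin m × Fin m → Fin m) (β : Fin m × Fin m) :
    Type := {g : Fin 9 // (F g β).val < sz g}

/-- Embedding of an inflated truncated block. -/
def blkMap {m : ℕ} (sz : Fin 9 → ℕ) (F : Fin 9 → Fin m × Fin m → Fin m) (β : Fin m × Fin m)
    (p : LiveGrp sz F β × Fin 3) : BigPt sz :=
  some (⟨p.1.1, ⟨(F p.1.1 β).val, p.1.2⟩⟩, p.2)

theorem blkMap_injective {m : ℕ} (sz : Fin 9 → ℕ) (F : Fin 9 → Fin m × Fin m → Fin m)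
    (β : Fin m × Fin m) : Function.Injective (blkMap sz F β) := by
  rintro ⟨⟨g, hg⟩, k⟩ ⟨⟨g', hg'⟩, k'⟩ h
  simp only [blkMap, Option.some.injEq, Prod.mk.injEq] at h
  have h1 : g = g' := congrArg Sigma.fst h.1
  subst h1
  rw [h.2]

theorem big_piece {m : ℕ} (sz : Fin 9 → ℕ) (hsz : ∀ g, sz g ≤ m)
    (hfull : ∀ g : Fin 9, g.val < 6 → sz g = m) (F : Fin 9 → Fin m × Fin m → Fin m)
    (hF : ∀ g h, g ≠ h → Function.Injective (fun β => (F g β, F h β)))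
    (hD : ∀ g, ∃ D : DirectedDesign (Fin (3 * sz g + 1)) 2 4 2, D.SuperSimple ∧ D.DefiningHalf) :
    ∃ B : Multiset (List (BigPt sz)), Piece (fun _ _ => True) B := by
  have hgrp : ∀ g, ∃ B : Multiset (List (BigPt sz)), Piece (fun x y =>
      ∃ u v, grpMap sz g u = x ∧ grpMap sz g v = y) B := by
    intro g
    obtain ⟨D, h1, h2⟩ := hD g
    let e : Fin (3 * sz g + 1) ≃ Option (Fin (sz g) × Fin 3) :=
      Fintype.equivOfCardEq (by simp; omega)
    have hp := (piece_of_design D h1 h2).map (φ := fun z => grpMap sz g (e z)) (s := Set.univ)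
      (((grpMap_injective sz g).comp e.injective).injOn) (by simp)
    refine ⟨_, hp.congr ?_⟩
    intro x y _
    constructor
    · rintro ⟨u, v, hu, hv, _⟩; exact ⟨e u, e v, hu, hv⟩
    · rintro ⟨u, v, hu, hv⟩
      exact ⟨e.symm u, e.symm v, by simpa using hu, by simpa using hv, trivial⟩
  have hblk : ∀ β, ∃ B : Multiset (List (BigPt sz)), Piece (fun x y =>
      ∃ u v, blkMap sz F β u = x ∧ blkMap sz F β v = y ∧ u.1 ≠ v.1) B := by
    intro β
    obtain ⟨B, hB⟩ := exists_ingredient (LiveGrp sz F β)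
      (by
        have hinj : Function.Injective (fun i : Fin 6 => (⟨Fin.castLE (by omega) i, by
            rw [hfull _ (by simp)]; exact (F _ β).isLt⟩ : LiveGrp sz F β)) := by
          intro i j hij
          simpa using hij
        simpa using Fintype.card_le_of_injective _ hinj)
      (by simpa using Fintype.card_subtype_le (fun g : Fin 9 => (F g β).val < sz g))
    exact ⟨_, hB.map (s := Set.univ) (blkMap_injective sz F β).injOn (by simp)⟩
  choose Bg hBg using hgrp
  choose Bb hBb using hblk
  let R : Fin 9 ⊕ (Fin m × Fin m) → BigPt sz → BigPt sz → Prop := fun i x y =>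
    match i with
    | Sum.inl g => ∃ u v, grpMap sz g u = x ∧ grpMap sz g v = y
    | Sum.inr β => ∃ u v, blkMap sz F β u = x ∧ blkMap sz F β v = y ∧ u.1 ≠ v.1
  let B : Fin 9 ⊕ (Fin m × Fin m) → Multiset (List (BigPt sz)) := Sum.elim Bg Bb
  refine ⟨∑ i, B i, Piece.glue (R := R) ?_ ?_ ?_ ?_⟩
  · rintro (g | β)
    · exact hBg g
    · exact hBb β
  · rintro (g | β) x y h
    · obtain ⟨u, v, hu, hv⟩ := h; exact ⟨v, u, hv, hu⟩
    · obtain ⟨u, v, hu, hv, hne⟩ := h; exact ⟨v, u, hv, hu, hne.symm⟩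
  · intro x y hxy
    match x, y, hxy with
    | none, none, hxy => exact absurd rfl hxy
    | none, some (⟨g, w⟩, k), _ => exact ⟨Sum.inl g, none, some (w, k), rfl, rfl⟩
    | some (⟨g, w⟩, k), none, _ => exact ⟨Sum.inl g, some (w, k), none, rfl, rfl⟩
    | some (⟨g, w⟩, k), some (⟨h, z⟩, l), _ =>
      by_cases hgh : g = h
      · subst hgh
        exact ⟨Sum.inl g, some (w, k), some (z, l), rfl, rfl⟩
      · have hsurj := Finite.surjective_of_injective (hF g h hgh)
        obtain ⟨β, hβ⟩ := hsurj (⟨w.val, w.isLt.trans_le (hsz g)⟩, ⟨z.val, z.isLt.trans_le (hsz h)⟩)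
        have h1 : (F g β).val = w.val := congrArg (fun q : Fin m × Fin m => q.1.val) hβ
        have h2 : (F h β).val = z.val := congrArg (fun q : Fin m × Fin m => q.2.val) hβ
        refine ⟨Sum.inr β, (⟨g, by rw [h1]; exact w.isLt⟩, k), (⟨h, by rw [h2]; exact z.isLt⟩, l),
          ?_, ?_, ?_⟩
        · simp only [blkMap, h1]
        · simp only [blkMap, h2]
        · intro he; exact hgh (congrArg Subtype.val he)
  · have mixed : ∀ x y, x ≠ y → ∀ g β, R (Sum.inl g) x y → R (Sum.inr β) x y → False := by
      rintro x y _ g β ⟨u, v, hu, hv⟩ ⟨⟨⟨p, hp⟩, k⟩, ⟨⟨q, hq⟩, l⟩, hpx, hqy, hne⟩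
      subst hpx hqy
      have hg : ∀ (o : Option (Fin (sz g) × Fin 3)) (p : Fin 9) (w : Fin (sz p)) (k : Fin 3),
          grpMap sz g o = some (⟨p, w⟩, k) → g = p := by
        intro o p w k ho
        match o, ho with
        | some (w', k'), ho =>
          simp only [grpMap, Option.map_some, Option.some.injEq, Prod.mk.injEq] at ho
          exact congrArg Sigma.fst ho.1
      have e1 := hg u _ _ _ hu
      have e2 := hg v _ _ _ hv
      exact hne (Subtype.ext (e1.symm.trans e2))
    rintro x y hxy (g | β) (g' | β') h h'
    · obtain ⟨u, v, hu, hv⟩ := h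
      obtain ⟨u', v', hu', hv'⟩ := h'
      subst hu hv
      congr 1
      have hg : ∀ (o : Option (Fin (sz g) × Fin 3)) (o' : Option (Fin (sz g') × Fin 3)),
          o ≠ none → grpMap sz g' o' = grpMap sz g o → g = g' := by
        intro o o' ho he
        match o, o', ho, he with
        | none, _, ho, _ => exact absurd rfl ho
        | some _, none, _, he => simp [grpMap] at he
        | some (w, k), some (w', k'), _, he =>
          simp only [grpMap, Option.map_some, Option.some.injEq, Prod.mk.injEq] at he
          exact (congrArg Sigma.fst he.1).symm
      by_cases hun : u = none
      · refine hg v v' ?_ hv'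
        rintro rfl
        exact hxy (by rw [hun])
      · exact hg u u' hun hu'
    · exact (mixed x y hxy _ _ h h').elim
    · exact (mixed x y hxy _ _ h' h).elim
    · obtain ⟨⟨⟨p, hp⟩, k⟩, ⟨⟨q, hq⟩, l⟩, hpx, hqy, hne⟩ := h
      obtain ⟨⟨⟨p', hp'⟩, k'⟩, ⟨⟨q', hq'⟩, l'⟩, hpx', hqy', hne'⟩ := h'
      subst hpx hqy
      simp only [blkMap, Option.some.injEq, Prod.mk.injEq] at hpx' hqy'
      obtain rfl : p' = p := congrArg Sigma.fst hpx'.1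
      obtain rfl : q' = q := congrArg Sigma.fst hqy'.1
      have e1 := hpx'.1
      have e2 := hqy'.1
      simp only [Sigma.mk.injEq, heq_eq_eq, true_and, Fin.mk.injEq] at e1 e2
      congr 1
      have hpq : p' ≠ q' := fun e => hne (Subtype.ext e)
      exact (hF p' q' hpq (Prod.ext (Fin.ext e1) (Fin.ext e2))).symm

/-- If `N(m) ≥ 7` and `0 ≤ a, b, c ≤ m`, and for each
`v ∈ {3m+1, 3a+1, 3b+1, 3c+1}` there is a super-simple `2-(v,4,2)` directed
design in which every defining set contains at least half of the blocks,
then there is such a design on `18m + 3a + 3b + 3c + 1` points. -/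
theorem superSimple_DD_half_of_seven_MOLS (m a b c : ℕ) (hm : 0 < m)
    (hMOLS : ∃ f : Fin 7 → Fin m → Fin m → Fin m, AreMOLS f)
    (ha : a ≤ m) (hb : b ≤ m) (hc : c ≤ m)
    (hinput : ∀ v ∈ ({3 * m + 1, 3 * a + 1, 3 * b + 1, 3 * c + 1} : Finset ℕ),
      ∃ D : DirectedDesign (Fin v) 2 4 2, D.SuperSimple ∧ D.DefiningHalf) :
    ∃ D : DirectedDesign (Fin (18 * m + 3 * a + 3 * b + 3 * c + 1)) 2 4 2,
      D.SuperSimple ∧ D.DefiningHalf := by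
  obtain ⟨f, hf⟩ := hMOLS
  let sz : Fin 9 → ℕ := ![m, m, m, m, m, m, a, b, c]
  have hcase : ∀ g, sz g = m ∨ sz g = a ∨ sz g = b ∨ sz g = c := by
    intro g; fin_cases g <;> simp [sz]
  have hsz : ∀ g, sz g ≤ m := by
    intro g; rcases hcase g with h | h | h | h <;> omega
  have hfull : ∀ g : Fin 9, g.val < 6 → sz g = m := by
    intro g hg; fin_cases g <;> simp [sz] at hg ⊢
  have hD : ∀ g, ∃ D : DirectedDesign (Fin (3 * sz g + 1)) 2 4 2,
      D.SuperSimple ∧ D.DefiningHalf := by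
    intro g
    apply hinput
    rcases hcase g with h | h | h | h <;> simp [h]
  obtain ⟨B, hB⟩ := big_piece sz hsz hfull (tdCoord f) (tdCoord_injective hf) hD
  have hcard : Fintype.card (BigPt sz) =
      Fintype.card (Fin (18 * m + 3 * a + 3 * b + 3 * c + 1)) := by
    simp [BigPt, Fin.sum_univ_succ, sz]
    ring
  let e : BigPt sz ≃ Fin (18 * m + 3 * a + 3 * b + 3 * c + 1) := Fintype.equivOfCardEq hcard
  have hE := (hB.map (φ := e) (s := Set.univ) e.injective.injOn (by simp)).congr
    (R' := fun _ _ => True) (by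
      intro x y _
      simp only [and_true, iff_true]
      exact ⟨e.symm x, e.symm y, by simp, by simp⟩)
  exact design_of_piece hE
end
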